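/- arXiv:2212.03130 — 3 statements merged into one kernel-verified Lean document; each statement's English description precedes it below -/
import Mathlib

section
/- There exists a constant C > 0 such that for every ε ∈ (0, 1/2) there is a ReLU neural network Φ_ε : ℝ² → ℝ of size at most C · log₂(1/ε) satisfying |Φ_ε(x, y) − x·y| ≤ ε for all x, y ∈ [0,1]. -/
/-- A ReLU neural network mapping `ℝⁿ` to `ℝᵐ`, given as a chain of affine layers
`T_L ∘ ρ ∘ T_{L-1} ∘ ⋯ ∘ ρ ∘ T₁` with componentwise ReLU activation `ρ` between
consecutive affine maps. -/
inductive ReLUNet : ℕ → ℕ → Type where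
  | last {n m : ℕ} (W : Matrix (Fin m) (Fin n) ℝ) (b : Fin m → ℝ) : ReLUNet n m
  | layer {n m k : ℕ} (W : Matrix (Fin m) (Fin n) ℝ) (b : Fin m → ℝ)
      (rest : ReLUNet m k) : ReLUNet n k

namespace ReLUNet

/-- The function realized by a ReLU network. -/
noncomputable def eval : {n m : ℕ} → ReLUNet n m → (Fin n → ℝ) → (Fin m → ℝ)
  | _, _, last W b, x => W.mulVec x + b
  | _, _, layer W b rest, x => rest.eval (fun i => max ((W.mulVec x + b) i) 0)

/-- The size of a ReLU network: the total number of nonzero entries of its weight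
matrices and bias vectors. -/
noncomputable def size : {n m : ℕ} → ReLUNet n m → ℕ
  | _, _, last W b =>
      Set.ncard {p : _ × _ | W p.1 p.2 ≠ 0} + Set.ncard {i | b i ≠ 0}
  | _, _, layer W b rest =>
      Set.ncard {p : _ × _ | W p.1 p.2 ≠ 0} + Set.ncard {i | b i ≠ 0} + rest.size

end ReLUNet

namespace ReLUNet

/-- The number of nonzero entries of a matrix and of a bias vector is at most the number of all
their entries. -/
theorem ncard_ne_zero_add_le {n m : ℕ} (W : Matrix (Fin m) (Fin n) ℝ) (b : Fin m → ℝ) :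
    Set.ncard {p : Fin m × Fin n | W p.1 p.2 ≠ 0} + Set.ncard {i | b i ≠ 0} ≤ m * n + m := by
  have hW := Set.ncard_le_card {p : Fin m × Fin n | W p.1 p.2 ≠ 0}
  have hb := Set.ncard_le_card {i | b i ≠ 0}
  simp only [Nat.card_eq_fintype_card, Fintype.card_prod, Fintype.card_fin] at hW hb
  omega

theorem size_last_le {n m : ℕ} (W : Matrix (Fin m) (Fin n) ℝ) (b : Fin m → ℝ) :
    (last W b).size ≤ m * n + m :=
  ncard_ne_zero_add_le W b

theorem size_layer_le {n m k : ℕ} (W : Matrix (Fin m) (Fin n) ℝ) (b : Fin m → ℝ)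
    (rest : ReLUNet m k) : (layer W b rest).size ≤ m * n + m + rest.size :=
  Nat.add_le_add_right (ncard_ne_zero_add_le W b) _

/-- A network of depth `k + 1` which, on the input `(a, (a - 1/2)⁺, b, (b - 1/2)⁺, p, q)`,
approximates `c * (p - q + a ^ 2 - b ^ 2)`. Each hidden layer applies the tent map
`t ↦ 2 * t - 4 * (t - 1/2)⁺` to `a` and to `b`. -/
noncomputable def squareDiff : ℕ → ℝ → ReLUNet 6 1
  | 0, c => last !![0, 0, 0, 0, c, -c] ![0]
  | k + 1, c =>
      layer
        !![2, -4, 0, 0, 0, 0;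
           2, -4, 0, 0, 0, 0;
           0, 0, 2, -4, 0, 0;
           0, 0, 2, -4, 0, 0;
           0, 8, 0, 0, 4, 0;
           0, 0, 0, 8, 0, 4]
        ![0, -1 / 2, 0, -1 / 2, 0, 0] (squareDiff k (c / 4))

theorem size_squareDiff_le (k : ℕ) (c : ℝ) : (squareDiff k c).size ≤ 42 * k + 7 := by
  induction k generalizing c with
  | zero => exact size_last_le _ _
  | succ k ih =>
    have h := ih (c / 4)
    exact (size_layer_le _ _ _).trans (by omega)

/-- The tent map preserves `[0, 1]` and reduces squaring to squaring of its value. -/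
theorem tent_spec {t : ℝ} (ht : t ∈ Set.Icc (0 : ℝ) 1) :
    2 * t - 4 * max (t - 1 / 2) 0 ∈ Set.Icc (0 : ℝ) 1 ∧
      (2 * t - 4 * max (t - 1 / 2) 0) ^ 2 = 4 * t ^ 2 - 8 * max (t - 1 / 2) 0 := by
  obtain ⟨h0, h1⟩ := ht
  rcases le_total t (1 / 2) with h | h
  · rw [max_eq_right (by linarith)]
    exact ⟨⟨by linarith, by linarith⟩, by ring⟩
  · rw [max_eq_left (by linarith)]
    exact ⟨⟨by linarith, by linarith⟩, by ring⟩

theorem abs_eval_squareDiff_sub_le (k : ℕ) {c a b p q : ℝ} (hc : 0 ≤ c)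
    (ha : a ∈ Set.Icc (0 : ℝ) 1) (hb : b ∈ Set.Icc (0 : ℝ) 1) (hp : 0 ≤ p) (hq : 0 ≤ q) :
    |(squareDiff k c).eval ![a, max (a - 1 / 2) 0, b, max (b - 1 / 2) 0, p, q] 0
      - c * (p - q + a ^ 2 - b ^ 2)| ≤ c / 4 ^ k := by
  induction k generalizing c a b p q with
  | zero =>
    have hab : |a ^ 2 - b ^ 2| ≤ 1 := by
      obtain ⟨ha0, ha1⟩ := ha
      obtain ⟨hb0, hb1⟩ := hb
      rw [abs_le]
      constructor <;> nlinarith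
    have key : (squareDiff 0 c).eval ![a, max (a - 1 / 2) 0, b, max (b - 1 / 2) 0, p, q] 0
        - c * (p - q + a ^ 2 - b ^ 2) = -(c * (a ^ 2 - b ^ 2)) := by
      simp [squareDiff, eval]
      ring
    rw [key, abs_neg, abs_mul, abs_of_nonneg hc, pow_zero, div_one]
    exact mul_le_of_le_one_right hc hab
  | succ k ih =>
    obtain ⟨ha', ha2⟩ := tent_spec ha
    obtain ⟨hb', hb2⟩ := tent_spec hb
    have hp' : 0 ≤ 4 * p + 8 * max (a - 1 / 2) 0 := by positivity
    have hq' : 0 ≤ 4 * q + 8 * max (b - 1 / 2) 0 := by positivity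
    have h := ih (c := c / 4) (by positivity) ha' hb' hp' hq'
    rw [ha2, hb2] at h
    have key : (squareDiff (k + 1) c).eval
          ![a, max (a - 1 / 2) 0, b, max (b - 1 / 2) 0, p, q] =
        (squareDiff k (c / 4)).eval
          ![2 * a - 4 * max (a - 1 / 2) 0, max (2 * a - 4 * max (a - 1 / 2) 0 - 1 / 2) 0,
            2 * b - 4 * max (b - 1 / 2) 0, max (2 * b - 4 * max (b - 1 / 2) 0 - 1 / 2) 0,
            4 * p + 8 * max (a - 1 / 2) 0, 4 * q + 8 * max (b - 1 / 2) 0] := by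
      rw [squareDiff, eval]
      congr 1
      generalize max (a - 1 / 2) 0 = va at *
      generalize max (b - 1 / 2) 0 = vb at *
      have ea := max_eq_left ha'.1
      have eb := max_eq_left hb'.1
      have ep := max_eq_left hp'
      have eq := max_eq_left hq'
      funext i
      fin_cases i <;>
        simp <;> ring_nf at * <;> assumption
    rw [div_div, ← pow_succ'] at h
    rw [key]
    convert h using 3
    ring

/-- A network approximating multiplication on `[0, 1]²` through
`x * y = ((x + y) / 2) ^ 2 - (|x - y| / 2) ^ 2`. -/
noncomputable def approxMul (k : ℕ) : ReLUNet 2 1 :=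
  layer !![1, 1; 1, -1; -1, 1] ![0, 0, 0]
    (layer
      !![1 / 2, 0, 0;
         1 / 2, 0, 0;
         0, 1 / 2, 1 / 2;
         0, 1 / 2, 1 / 2;
         0, 0, 0;
         0, 0, 0]
      ![0, -1 / 2, 0, -1 / 2, 0, 0] (squareDiff k 1))

theorem size_approxMul_le (k : ℕ) : (approxMul k).size ≤ 42 * k + 40 := by
  have h := size_squareDiff_le k 1
  refine (size_layer_le _ _ _).trans ?_
  exact (Nat.add_le_add_left (size_layer_le _ _ _) _).trans (by omega)

theorem abs_eval_approxMul_sub_le (k : ℕ) {x y : ℝ} (hx : x ∈ Set.Icc (0 : ℝ) 1)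
    (hy : y ∈ Set.Icc (0 : ℝ) 1) : |(approxMul k).eval ![x, y] 0 - x * y| ≤ 1 / 4 ^ k := by
  obtain ⟨hx0, hx1⟩ := hx
  obtain ⟨hy0, hy1⟩ := hy
  have ha : (x + y) / 2 ∈ Set.Icc (0 : ℝ) 1 := ⟨by linarith, by linarith⟩
  have hb : |x - y| / 2 ∈ Set.Icc (0 : ℝ) 1 :=
    ⟨by positivity, by linarith [abs_le.2 (⟨by linarith, by linarith⟩ : -1 ≤ x - y ∧ x - y ≤ 1)]⟩
  have h := abs_eval_squareDiff_sub_le k zero_le_one ha hb le_rfl le_rfl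
  have key : (approxMul k).eval ![x, y] = (squareDiff k 1).eval
      ![(x + y) / 2, max ((x + y) / 2 - 1 / 2) 0, |x - y| / 2, max (|x - y| / 2 - 1 / 2) 0,
        0, 0] := by
    have ed : max (x - y) 0 + max (y - x) 0 = |x - y| := by
      rw [← neg_sub x y]
      exact posPart_add_negPart (x - y)
    have hW : (fun i => max (((!![1, 1; 1, -1; -1, 1] : Matrix (Fin 3) (Fin 2) ℝ).mulVec ![x, y]
        + ![0, 0, 0] : Fin 3 → ℝ) i) 0) = ![x + y, max (x - y) 0, max (y - x) 0] := by
      funext i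
      fin_cases i
      · simpa using add_nonneg hx0 hy0
      · simp [sub_eq_add_neg]
      · simp [sub_eq_add_neg, add_comm]
    rw [approxMul, eval, eval, hW]
    congr 1
    have ea := max_eq_left ha.1
    have eb := max_eq_left hb.1
    rw [← ed] at eb ⊢
    generalize max (x - y) 0 = u at *
    generalize max (y - x) 0 = v at *
    funext i
    fin_cases i <;>
      simp <;> ring_nf at * <;> assumption
  rw [key]
  convert h using 3
  rw [div_pow, div_pow, sq_abs]
  ring

end ReLUNet

/-- **Approximate multiplication by ReLU networks.** There is a constant `C > 0` such
that for every `ε ∈ (0, 1/2)` there is a ReLU network `Φ_ε : ℝ² → ℝ` of size at most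
`C · log₂(1/ε)` with `|Φ_ε(x,y) - x·y| ≤ ε` for all `x, y ∈ [0,1]`. -/
theorem relu_multiplication_approx :
    ∃ C : ℝ, 0 < C ∧
      ∀ ε : ℝ, ε ∈ Set.Ioo (0 : ℝ) (1 / 2) →
        ∃ Φ : ReLUNet 2 1,
          (Φ.size : ℝ) ≤ C * Real.logb 2 (1 / ε) ∧
          ∀ x ∈ Set.Icc (0 : ℝ) 1, ∀ y ∈ Set.Icc (0 : ℝ) 1,
            |Φ.eval ![x, y] 0 - x * y| ≤ ε := by
  refine ⟨124, by norm_num, fun ε ⟨hε0, hε⟩ => ?_⟩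
  set l := Real.logb 2 (1 / ε) with hl
  have hl1 : 1 ≤ l := by
    rw [hl, Real.le_logb_iff_rpow_le one_lt_two (by positivity), Real.rpow_one,
      le_div_iff₀ hε0]
    linarith
  refine ⟨ReLUNet.approxMul ⌈l⌉₊, ?_, fun x hx y hy =>
    (ReLUNet.abs_eval_approxMul_sub_le _ hx hy).trans ?_⟩
  · have hsize : ((ReLUNet.approxMul ⌈l⌉₊).size : ℝ) ≤ 42 * ⌈l⌉₊ + 40 := by
      exact_mod_cast ReLUNet.size_approxMul_le ⌈l⌉₊
    linarith [Nat.ceil_lt_add_one (zero_le_one.trans hl1)]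
  · have h2 : 1 / ε ≤ 2 ^ ⌈l⌉₊ := by
      rw [← Real.rpow_natCast, ← Real.logb_le_iff_le_rpow one_lt_two (by positivity)]
      exact Nat.le_ceil l
    have h4 : (2 : ℝ) ^ ⌈l⌉₊ ≤ 4 ^ ⌈l⌉₊ := by gcongr; norm_num
    rw [one_div_le (by positivity) hε0]
    exact h2.trans h4
end

section
/- There exists a constant C > 0 such that for every dimension d ∈ ℕ and every ε ∈ (0, 1/2) there is a ReLU neural network Φ : ℝ^{d×d} × ℝ^{d×d} → ℝ^{d×d} of size at most C · d³ · log₂(1/ε) such that for all matrices A, B ∈ ℝ^{d×d} with all entries bounded in absolute value by 1, one has max_{i,j} | Φ(A, B)_{ij} − (A B)_{ij} | ≤ ε. -/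
/-- Identification of a `d × d` real matrix with a vector in `ℝ^{d²}`. -/
def matToVec {d : ℕ} (A : Matrix (Fin d) (Fin d) ℝ) : Fin (d * d) → ℝ :=
  fun i => A (finProdFinEquiv.symm i).1 (finProdFinEquiv.symm i).2

/-- Identification of a vector in `ℝ^{d²}` with a `d × d` real matrix. -/
def vecToMat {d : ℕ} (v : Fin (d * d) → ℝ) : Matrix (Fin d) (Fin d) ℝ :=
  fun i j => v (finProdFinEquiv (i, j))

open Matrix

/-- The number of nonzero entries of a matrix. -/
noncomputable def nnz {κ ι : Type} (M : Matrix κ ι ℝ) : ℕ :=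
  Set.ncard {p : κ × ι | M p.1 p.2 ≠ 0}

/-- The number of nonzero entries of a vector. -/
noncomputable def vecNnz {κ : Type} (b : κ → ℝ) : ℕ := Set.ncard {i | b i ≠ 0}

/-- Componentwise ReLU. -/
noncomputable def relu {κ : Type} (x : κ → ℝ) : κ → ℝ := fun i => max (x i) 0

/-- `Realizes f s` says that `f` is computed by a ReLU network of size at most `s`, with
layers indexed by arbitrary finite types. -/
inductive Realizes {κ : Type} : {ι : Type} → [Fintype ι] → ((ι → ℝ) → (κ → ℝ)) → ℕ → Prop
  | last {ι : Type} [Fintype ι] (M : Matrix κ ι ℝ) (b : κ → ℝ) :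
      Realizes (fun x => M *ᵥ x + b) (nnz M + vecNnz b)
  | layer {ι μ : Type} [Fintype ι] [Fintype μ] (M : Matrix μ ι ℝ) (b : μ → ℝ)
      {g : (μ → ℝ) → (κ → ℝ)} {s : ℕ} (hg : Realizes g s) :
      Realizes (fun x => g (relu (M *ᵥ x + b))) (nnz M + vecNnz b + s)

lemma nnz_reindex {κ ι κ' ι' : Type} (e : κ ≃ κ') (e' : ι ≃ ι') (M : Matrix κ ι ℝ) :
    nnz (Matrix.reindex e e' M) = nnz M := by
  unfold nnz
  rw [← Set.ncard_image_of_injective _ (e.prodCongr e').injective]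
  congr 1
  ext ⟨a, b⟩
  simp only [Set.mem_ofPred_eq, Set.mem_image, Prod.exists, Equiv.prodCongr_apply, Prod.map,
    Prod.mk.injEq, Matrix.reindex_apply, Matrix.submatrix_apply]
  constructor
  · intro h
    exact ⟨_, _, h, by simp, by simp⟩
  · rintro ⟨x, y, h, rfl, rfl⟩
    simpa using h

lemma vecNnz_reindex {κ κ' : Type} (e : κ ≃ κ') (b : κ → ℝ) :
    vecNnz (b ∘ e.symm) = vecNnz b := by
  unfold vecNnz
  rw [← Set.ncard_image_of_injective _ e.injective]
  congr 1
  ext a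
  simp only [Set.mem_ofPred_eq, Set.mem_image, Function.comp_apply]
  constructor
  · intro h
    exact ⟨_, h, by simp⟩
  · rintro ⟨x, h, rfl⟩
    simpa using h

lemma reindex_mulVec_add {κ ι κ' ι' : Type} [Fintype ι] [Fintype ι'] (e : κ ≃ κ') (e' : ι ≃ ι')
    (M : Matrix κ ι ℝ) (b : κ → ℝ) (x : ι → ℝ) :
    Matrix.reindex e e' M *ᵥ (x ∘ e'.symm) + b ∘ e.symm = (M *ᵥ x + b) ∘ e.symm := by
  rw [Matrix.reindex_apply, Matrix.submatrix_mulVec_equiv]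
  ext i
  simp [Function.comp_assoc]

/-- A realizable function is the evaluation of a `ReLUNet`, for any enumeration of its
input and output coordinates. -/
lemma Realizes.exists_net {κ ι : Type} [Fintype ι] {f : (ι → ℝ) → (κ → ℝ)} {s : ℕ}
    (h : Realizes f s) {n m : ℕ} (e : ι ≃ Fin n) (e' : κ ≃ Fin m) :
    ∃ Φ : ReLUNet n m, Φ.size ≤ s ∧ ∀ x, Φ.eval (x ∘ e.symm) = f x ∘ e'.symm := by
  induction h generalizing n with
  | last M b =>
    refine ⟨.last (Matrix.reindex e' e M) (b ∘ e'.symm), ?_, fun x => ?_⟩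
    · exact (congrArg₂ (· + ·) (nnz_reindex e' e M) (vecNnz_reindex e' b)).le
    · exact reindex_mulVec_add e' e M b x
  | @layer ι μ _ _ M b g s hg ih =>
    obtain ⟨Φ, hs, hΦ⟩ := ih (Fintype.equivFin μ)
    set e'' := Fintype.equivFin μ
    refine ⟨.layer (Matrix.reindex e'' e M) (b ∘ e''.symm) Φ, ?_, fun x => ?_⟩
    · have h1 := nnz_reindex e'' e M
      have h2 := vecNnz_reindex e'' b
      change nnz (Matrix.reindex e'' e M) + vecNnz (b ∘ e''.symm) + Φ.size ≤ _
      omega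
    · rw [ReLUNet.eval, reindex_mulVec_add, ← hΦ]
      rfl

lemma nnz_le_card_of_injOn {κ ι α : Type} [Finite κ] [Finite ι] [Fintype α] (M : Matrix κ ι ℝ)
    (f : κ × ι → α) (hf : Set.InjOn f {p | M p.1 p.2 ≠ 0}) : nnz M ≤ Fintype.card α := by
  rw [← Nat.card_eq_fintype_card, ← Set.ncard_univ]
  exact Set.ncard_le_ncard_of_injOn f (fun _ _ => Set.mem_univ _) hf

lemma vecNnz_le_card {κ : Type} [Fintype κ] (b : κ → ℝ) : vecNnz b ≤ Fintype.card κ := by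
  rw [← Nat.card_eq_fintype_card, ← Set.ncard_univ]
  exact Set.ncard_le_ncard (Set.subset_univ _)

@[simp] lemma vecNnz_zero {κ : Type} : vecNnz (0 : κ → ℝ) = 0 := by simp [vecNnz]

lemma nnz_neg {κ ι : Type} (M : Matrix κ ι ℝ) : nnz (-M) = nnz M := by simp [nnz]

lemma nnz_transpose {κ ι : Type} (M : Matrix κ ι ℝ) : nnz Mᵀ = nnz M := by
  unfold nnz
  rw [← Set.ncard_image_of_injective _ Prod.swap_injective]
  congr 1
  ext ⟨a, b⟩
  simp

lemma nnz_fromCols_le {κ ι ι' : Type} [Finite κ] [Finite ι] [Finite ι'] (M : Matrix κ ι ℝ)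
    (N : Matrix κ ι' ℝ) : nnz (Matrix.fromCols M N) ≤ nnz M + nnz N := by
  unfold nnz
  rw [← Set.ncard_image_of_injective {p : κ × ι | M p.1 p.2 ≠ 0}
      (f := Prod.map id (Sum.inl (β := ι'))) (Function.injective_id.prodMap Sum.inl_injective),
    ← Set.ncard_image_of_injective {p : κ × ι' | N p.1 p.2 ≠ 0}
      (f := Prod.map id (Sum.inr (α := ι))) (Function.injective_id.prodMap Sum.inr_injective)]
  refine (Set.ncard_le_ncard ?_).trans (Set.ncard_union_le _ _)
  rintro ⟨a, b | b⟩ h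
  · exact Or.inl ⟨(a, b), h, rfl⟩
  · exact Or.inr ⟨(a, b), h, rfl⟩

lemma nnz_fromRows_le {κ κ' ι : Type} [Finite κ] [Finite κ'] [Finite ι] (M : Matrix κ ι ℝ)
    (N : Matrix κ' ι ℝ) : nnz (Matrix.fromRows M N) ≤ nnz M + nnz N := by
  rw [← nnz_transpose, Matrix.transpose_fromRows, ← nnz_transpose M, ← nnz_transpose N]
  exact nnz_fromCols_le _ _

lemma fromCols_neg_mulVec_relu {κ μ ι : Type} [Fintype μ] [Fintype ι] (N : Matrix κ μ ℝ)
    (M : Matrix μ ι ℝ) (x : ι → ℝ) :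
    Matrix.fromCols N (-N) *ᵥ relu (Matrix.fromRows M (-M) *ᵥ x + 0) = N *ᵥ (M *ᵥ x) := by
  have h : relu (Matrix.fromRows M (-M) *ᵥ x + 0)
      = Sum.elim (relu (M *ᵥ x)) (relu (-(M *ᵥ x))) := by
    rw [Matrix.fromRows_mulVec, Matrix.neg_mulVec, add_zero]
    ext (i | i) <;> rfl
  rw [h, Matrix.fromCols_mulVec_sumElim, Matrix.neg_mulVec, ← Matrix.mulVec_neg,
    ← Matrix.mulVec_add]
  congr 1
  ext i
  simp only [relu, Pi.add_apply, Pi.neg_apply]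
  rcases le_total 0 ((M *ᵥ x) i) with h | h
  · rw [max_eq_left h, max_eq_right (by linarith)]; ring
  · rw [max_eq_right h, max_eq_left (by linarith)]; ring

lemma Realizes.comp_linear {κ μ ι : Type} [Fintype μ] [Fintype ι] [Finite κ]
    {f : (μ → ℝ) → (κ → ℝ)} {s : ℕ} (hf : Realizes f s) (M : Matrix μ ι ℝ) :
    ∃ s' ≤ 2 * nnz M + 2 * s, Realizes (fun x => f (M *ᵥ x)) s' := by
  have hM := nnz_fromRows_le M (-M)
  rw [nnz_neg] at hM
  have hz : vecNnz (0 : μ ⊕ μ → ℝ) = 0 := vecNnz_zero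
  cases hf with
  | last N b =>
    have h := Realizes.layer (Matrix.fromRows M (-M)) 0
      (Realizes.last (Matrix.fromCols N (-N)) b)
    simp only [fromCols_neg_mulVec_relu] at h
    have hN := nnz_fromCols_le N (-N)
    rw [nnz_neg] at hN
    exact ⟨_, by omega, h⟩
  | layer N b hg =>
    have h := Realizes.layer (Matrix.fromRows M (-M)) 0
      (Realizes.layer (Matrix.fromCols N (-N)) b hg)
    simp only [fromCols_neg_mulVec_relu] at h
    have hN := nnz_fromCols_le N (-N)
    rw [nnz_neg] at hN
    exact ⟨_, by omega, h⟩

/-- Coefficients of the left factors in Strassen's algorithm. -/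
def strassenLeft : Fin 7 → Fin 2 → Fin 2 → ℤ :=
  ![![![1, 0], ![0, 1]], ![![0, 0], ![1, 1]], ![![1, 0], ![0, 0]], ![![0, 0], ![0, 1]],
    ![![1, 1], ![0, 0]], ![![-1, 0], ![1, 0]], ![![0, 1], ![0, -1]]]

/-- Coefficients of the right factors in Strassen's algorithm. -/
def strassenRight : Fin 7 → Fin 2 → Fin 2 → ℤ :=
  ![![![1, 0], ![0, 1]], ![![1, 0], ![0, 0]], ![![0, 1], ![0, -1]], ![![-1, 0], ![1, 0]],
    ![![0, 0], ![0, 1]], ![![1, 1], ![0, 0]], ![![0, 0], ![1, 1]]]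

/-- Coefficients with which the products of Strassen's algorithm enter the output. -/
def strassenOut : Fin 7 → Fin 2 → Fin 2 → ℤ :=
  ![![![1, 0], ![0, 1]], ![![0, 0], ![1, -1]], ![![0, 1], ![0, 1]], ![![1, 0], ![1, 0]],
    ![![-1, 1], ![0, 0]], ![![0, 0], ![0, 1]], ![![1, 0], ![0, 0]]]

lemma strassen_identity (i j a b c e : Fin 2) :
    ∑ t, strassenOut t i j * strassenLeft t a b * strassenRight t c e
      = if a = i ∧ b = c ∧ e = j then 1 else 0 := by
  revert i j a b c e
  decide

/-- The `k`-fold tensor power of a coefficient array. -/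
def tensorPow (u : Fin 7 → Fin 2 → Fin 2 → ℤ) (k : ℕ) (t : Fin k → Fin 7)
    (a b : Fin k → Fin 2) : ℝ :=
  ∏ x, (u (t x) (a x) (b x) : ℝ)

lemma strassen_tensorPow_identity (k : ℕ) (i j a b c e : Fin k → Fin 2) :
    ∑ t, tensorPow strassenOut k t i j * tensorPow strassenLeft k t a b
        * tensorPow strassenRight k t c e
      = if a = i ∧ b = c ∧ e = j then 1 else 0 := by
  simp only [tensorPow, ← Finset.prod_mul_distrib]
  rw [← Fintype.prod_sum fun x t => ((strassenOut t (i x) (j x) : ℝ) *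
    (strassenLeft t (a x) (b x) : ℝ) * (strassenRight t (c x) (e x) : ℝ))]
  have h : ∀ x, ∑ t, ((strassenOut t (i x) (j x) : ℝ) * (strassenLeft t (a x) (b x) : ℝ) *
      (strassenRight t (c x) (e x) : ℝ))
        = if a x = i x ∧ b x = c x ∧ e x = j x then 1 else 0 := fun x => by
    exact_mod_cast strassen_identity (i x) (j x) (a x) (b x) (c x) (e x)
  simp only [h, Finset.prod_ite_zero, Finset.prod_const_one, Finset.mem_univ, forall_const,
    funext_iff, forall_and]

lemma abs_tensorPow_le_one {u : Fin 7 → Fin 2 → Fin 2 → ℤ} (hu : ∀ t a b, |u t a b| ≤ 1)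
    (k : ℕ) (t : Fin k → Fin 7) (a b : Fin k → Fin 2) : |tensorPow u k t a b| ≤ 1 := by
  rw [tensorPow, Finset.abs_prod]
  exact Finset.prod_le_one (fun _ _ => abs_nonneg _) fun x _ => by exact_mod_cast hu _ _ _

lemma ncard_tensorPow_support_le {u : Fin 7 → Fin 2 → Fin 2 → ℤ} {s : ℕ}
    (hu : Fintype.card {p : Fin 7 × Fin 2 × Fin 2 // u p.1 p.2.1 p.2.2 ≠ 0} = s) (k : ℕ) :
    Set.ncard {p : (Fin k → Fin 7) × (Fin k → Fin 2) × (Fin k → Fin 2) |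
      tensorPow u k p.1 p.2.1 p.2.2 ≠ 0} ≤ s ^ k := by
  have hc : Fintype.card (Fin k → {p : Fin 7 × Fin 2 × Fin 2 // u p.1 p.2.1 p.2.2 ≠ 0})
      = s ^ k := by simp [hu]
  rw [← hc, ← Nat.card_eq_fintype_card, ← Set.ncard_univ]
  refine (Set.ncard_le_ncard (t := (fun q => (fun x => (q x).1.1, fun x => (q x).1.2.1,
    fun x => (q x).1.2.2)) '' Set.univ) ?_).trans (Set.ncard_image_le)
  rintro ⟨t, a, b⟩ h
  refine ⟨fun x => ⟨(t x, a x, b x), fun h0 => h ?_⟩, Set.mem_univ _, rfl⟩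
  exact Finset.prod_eq_zero (Finset.mem_univ x) (by simpa using h0)

lemma card_strassenLeft_support :
    Fintype.card {p : Fin 7 × Fin 2 × Fin 2 // strassenLeft p.1 p.2.1 p.2.2 ≠ 0} = 12 := by
  decide

lemma card_strassenRight_support :
    Fintype.card {p : Fin 7 × Fin 2 × Fin 2 // strassenRight p.1 p.2.1 p.2.2 ≠ 0} = 12 := by
  decide

lemma card_strassenOut_support :
    Fintype.card {p : Fin 7 × Fin 2 × Fin 2 // strassenOut p.1 p.2.1 p.2.2 ≠ 0} = 12 := by
  decide

lemma abs_strassenLeft_le_one (t : Fin 7) (a b : Fin 2) : |strassenLeft t a b| ≤ 1 := by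
  revert t a b
  decide

lemma abs_strassenRight_le_one (t : Fin 7) (a b : Fin 2) : |strassenRight t a b| ≤ 1 := by
  revert t a b
  decide

lemma abs_strassenOut_le_one (t : Fin 7) (a b : Fin 2) : |strassenOut t a b| ≤ 1 := by
  revert t a b
  decide

/-- The block-diagonal matrix with a copy of `M` for each `p : P`. -/
def blockCopies (P : Type) [DecidableEq P] {α β : Type} (M : Matrix α β ℝ) :
    Matrix (P × α) (P × β) ℝ :=
  fun x y => if x.1 = y.1 then M x.2 y.2 else 0

lemma blockCopies_mulVec {P α β : Type} [DecidableEq P] [Fintype P] [Fintype β]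
    (M : Matrix α β ℝ) (x : P × β → ℝ) (p : P) (a : α) :
    (blockCopies P M *ᵥ x) (p, a) = ∑ b, M a b * x (p, b) := by
  simp [Matrix.mulVec, dotProduct, blockCopies, Fintype.sum_prod_type, ite_mul,
    Finset.sum_ite_irrel]

lemma nnz_blockCopies_le {P α β : Type} [DecidableEq P] [Fintype P] [Fintype α] [Fintype β]
    (M : Matrix α β ℝ) :
    nnz (blockCopies P M) ≤ Fintype.card P * Fintype.card α * Fintype.card β := by
  rw [← Fintype.card_prod, ← Fintype.card_prod]
  refine nnz_le_card_of_injOn _ (fun x => ((x.1.1, x.1.2), x.2.2)) ?_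
  rintro ⟨⟨p, a⟩, q, b⟩ h ⟨⟨p', a'⟩, q', b'⟩ h' heq
  simp only [Set.mem_ofPred_eq, blockCopies, ne_eq, ite_eq_right_iff, Classical.not_imp] at h h'
  simp only [Prod.mk.injEq] at heq
  grind

/-- One step of the sawtooth recursion for squaring, acting on a state
`(x, max (x - 1/2) 0, acc)`. -/
noncomputable def squareStep (P : Type) [Fintype P] [DecidableEq P] (x : P × Fin 3 → ℝ) :
    P × Fin 3 → ℝ :=
  relu (blockCopies P !![2, -4, 0; 2, -4, 0; -2, 4, 4] *ᵥ x + fun q => ![0, -1 / 2, 0] q.2)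

/-- The initial state of the squaring recursion at `|y|`, computed from the positive and
negative parts of `y`. -/
noncomputable def squareInit (P : Type) [Fintype P] [DecidableEq P] (x : P × Bool → ℝ) :
    P × Fin 3 → ℝ :=
  relu (blockCopies P (Matrix.of fun (_ : Fin 3) (_ : Bool) => (1 : ℝ)) *ᵥ x
    + fun q => ![0, -1 / 2, 0] q.2)

/-- The invariant of the squaring recursion after `n` steps, started at `|y p|`. -/
def SquareState {P : Type} (y : P → ℝ) (n : ℕ) (st : P × Fin 3 → ℝ) : Prop :=
  ∀ p, ∃ x : ℝ, 0 ≤ x ∧ x ≤ 1 ∧ st (p, 0) = x ∧ st (p, 1) = max (x - 1 / 2) 0 ∧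
    st (p, 2) = 4 ^ n * y p ^ 2 + x - x ^ 2

lemma squareState_init {P : Type} [Fintype P] [DecidableEq P] (y : P → ℝ)
    (hy : ∀ p, |y p| ≤ 1) (x : P × Bool → ℝ) (hx : ∀ p, x (p, true) + x (p, false) = |y p|) :
    SquareState y 0 (squareInit P x) := by
  intro p
  have h0 := abs_nonneg (y p)
  have h : ∀ a : Fin 3,
      (blockCopies P (Matrix.of fun (_ : Fin 3) (_ : Bool) => (1 : ℝ)) *ᵥ x) (p, a) = |y p| := by
    intro a
    rw [blockCopies_mulVec, Fintype.sum_bool, Matrix.of_apply, Matrix.of_apply, one_mul, one_mul,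
      hx]
  refine ⟨|y p|, h0, hy p, ?_, ?_, ?_⟩
  · simp [squareInit, relu, h]
  · simp [squareInit, relu, h]
    ring_nf
  · simp [squareInit, relu, h]

lemma squareState_step {P : Type} [Fintype P] [DecidableEq P] {y : P → ℝ} {n : ℕ}
    {st : P × Fin 3 → ℝ} (h : SquareState y n st) :
    SquareState y (n + 1) (squareStep P st) := by
  intro p
  obtain ⟨x, h0, h1, hu, hv, ha⟩ := h p
  have e0 : squareStep P st (p, 0) = max (2 * x - 4 * max (x - 1 / 2) 0) 0 := by
    simp [squareStep, relu, blockCopies_mulVec, Fin.sum_univ_three, hu, hv, sub_eq_add_neg]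
  have e1 : squareStep P st (p, 1) = max (2 * x - 4 * max (x - 1 / 2) 0 - 1 / 2) 0 := by
    simp [squareStep, relu, blockCopies_mulVec, Fin.sum_univ_three, hu, hv, sub_eq_add_neg]
    ring_nf
  have e2 : squareStep P st (p, 2)
      = max (-2 * x + 4 * max (x - 1 / 2) 0 + 4 * (4 ^ n * y p ^ 2 + x - x ^ 2)) 0 := by
    simp [squareStep, relu, blockCopies_mulVec, Fin.sum_univ_three, hu, hv, ha]
  have hpos : 0 ≤ 4 ^ n * y p ^ 2 := by positivity
  rcases le_total x (1 / 2) with hx | hx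
  · rw [max_eq_right (by linarith : x - 1 / 2 ≤ 0)] at e0 e1 e2
    refine ⟨2 * x, by linarith, by linarith, ?_, ?_, ?_⟩
    · rw [e0, max_eq_left (by linarith)]; ring
    · rw [e1]; ring_nf
    · rw [e2, max_eq_left (by nlinarith)]; ring
  · rw [max_eq_left (by linarith : 0 ≤ x - 1 / 2)] at e0 e1 e2
    refine ⟨2 - 2 * x, by linarith, by linarith, ?_, ?_, ?_⟩
    · rw [e0, max_eq_left (by linarith)]; ring
    · rw [e1]; ring_nf
    · rw [e2, max_eq_left (by nlinarith)]; ring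

lemma squareState_iterate {P : Type} [Fintype P] [DecidableEq P] {y : P → ℝ}
    {st : P × Fin 3 → ℝ} (h : SquareState y 0 st) (n : ℕ) :
    SquareState y n ((squareStep P)^[n] st) := by
  induction n with
  | zero => exact h
  | succ n ih => rw [Function.iterate_succ_apply']; exact squareState_step ih

lemma Realizes.comp_squareStep_iterate {P κ : Type} [Fintype P] [DecidableEq P]
    {f : (P × Fin 3 → ℝ) → (κ → ℝ)} {s : ℕ} (hf : Realizes f s) (n : ℕ) :
    ∃ s' ≤ 12 * Fintype.card P * n + s, Realizes (fun x => f ((squareStep P)^[n] x)) s' := by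
  induction n with
  | zero => exact ⟨s, by simp, hf⟩
  | succ n ih =>
    obtain ⟨s', hs', h⟩ := ih
    refine ⟨_, ?_, Realizes.layer (blockCopies P !![2, -4, 0; 2, -4, 0; -2, 4, 4])
      (fun q => ![0, -1 / 2, 0] q.2) h⟩
    have h1 := nnz_blockCopies_le (P := P)
      (!![2, -4, 0; 2, -4, 0; -2, 4, 4] : Matrix (Fin 3) (Fin 3) ℝ)
    have h2 := vecNnz_le_card (fun q : P × Fin 3 => (![0, -1 / 2, 0] : Fin 3 → ℝ) q.2)
    simp only [Fintype.card_prod, Fintype.card_fin] at h1 h2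
    linarith

lemma Realizes.comp_squareInit {P κ : Type} [Fintype P] [DecidableEq P]
    {f : (P × Fin 3 → ℝ) → (κ → ℝ)} {s : ℕ} (hf : Realizes f s) :
    ∃ s' ≤ 9 * Fintype.card P + s, Realizes (fun x => f (squareInit P x)) s' := by
  refine ⟨_, ?_, Realizes.layer (blockCopies P (Matrix.of fun (_ : Fin 3) (_ : Bool) => (1 : ℝ)))
      (fun q => ![0, -1 / 2, 0] q.2) hf⟩
  have h1 := nnz_blockCopies_le (P := P) (Matrix.of fun (_ : Fin 3) (_ : Bool) => (1 : ℝ))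
  have h2 := vecNnz_le_card (fun q : P × Fin 3 => (![0, -1 / 2, 0] : Fin 3 → ℝ) q.2)
  simp only [Fintype.card_prod, Fintype.card_fin, Fintype.card_bool] at h1 h2
  linarith

/-- The sign `1` or `-1` attached to a Boolean. -/
def boolSign (s : Bool) : ℝ := if s then 1 else -1

/-- The linear map sending two arrays `a`, `b` of `m × m` matrices indexed by `T` to
`± (a t i l ± b t l j) / (2 R)`. -/
noncomputable def pairSums (T : Type) [DecidableEq T] (m : ℕ) (R : ℝ) :
    Matrix ((((T × Fin m × Fin m) × Fin m) × Bool) × Bool)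
      ((T × Fin m × Fin m) ⊕ (T × Fin m × Fin m)) ℝ :=
  fun p => Sum.elim
    (fun z => if z = (p.1.1.1.1, p.1.1.1.2.1, p.1.1.2) then boolSign p.2 * (2 * R)⁻¹ else 0)
    (fun z => if z = (p.1.1.1.1, p.1.1.2, p.1.1.1.2.2) then
      boolSign p.2 * (boolSign p.1.2 * (2 * R)⁻¹) else 0)

/-- The linear map summing signed accumulators over the inner index. -/
def signedSum (X : Type) [DecidableEq X] (m : ℕ) (c : ℝ) :
    Matrix X (((X × Fin m) × Bool) × Fin 3) ℝ :=
  fun z p => if z = p.1.1.1 ∧ p.2 = 2 then boolSign p.1.2 * c else 0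

lemma pairSums_mulVec {T : Type} [Fintype T] [DecidableEq T] {m : ℕ} (R : ℝ)
    (x : (T × Fin m × Fin m) ⊕ (T × Fin m × Fin m) → ℝ) (t : T) (i j l : Fin m) (s σ : Bool) :
    (pairSums T m R *ᵥ x) ((((t, i, j), l), s), σ)
      = boolSign σ * ((x (.inl (t, i, l)) + boolSign s * x (.inr (t, l, j))) / (2 * R)) := by
  simp only [Matrix.mulVec, dotProduct, pairSums, Fintype.sum_sum_type, Sum.elim_inl,
    Sum.elim_inr, ite_mul, zero_mul, Finset.sum_ite_eq', Finset.mem_univ, if_true]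
  ring

lemma nnz_pairSums_le {T : Type} [Fintype T] [DecidableEq T] (m : ℕ) (R : ℝ) :
    nnz (pairSums T m R) ≤ 4 * Fintype.card (((T × Fin m × Fin m) × Fin m) × Bool) := by
  have hc : 4 * Fintype.card (((T × Fin m × Fin m) × Fin m) × Bool)
      = Fintype.card (((((T × Fin m × Fin m) × Fin m) × Bool) × Bool) × Bool) := by
    rw [Fintype.card_prod (_ × Bool), Fintype.card_prod (((T × Fin m × Fin m) × Fin m) × Bool),
      Fintype.card_bool]
    ring
  rw [hc]
  refine nnz_le_card_of_injOn _ (fun x => (x.1, x.2.isLeft)) ?_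
  rintro ⟨p, z | z⟩ h ⟨p', z' | z'⟩ h' heq <;>
  simp only [Set.mem_ofPred_eq, pairSums, Sum.elim_inl, Sum.elim_inr, ne_eq,
    ite_eq_right_iff, Classical.not_imp] at h h' <;>
  simp only [Prod.mk.injEq, Sum.isLeft] at heq <;> grind

lemma signedSum_mulVec {X : Type} [Fintype X] [DecidableEq X] {m : ℕ} (c : ℝ)
    (x : ((X × Fin m) × Bool) × Fin 3 → ℝ) (z : X) :
    (signedSum X m c *ᵥ x) z
      = ∑ l, c * (x (((z, l), true), 2) - x (((z, l), false), 2)) := by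
  simp only [Matrix.mulVec, dotProduct, signedSum, Fintype.sum_prod_type]
  rw [Finset.sum_eq_single z]
  · refine Finset.sum_congr rfl fun l _ => ?_
    simp [boolSign]
    ring
  · intro b _ hb
    simp [hb.symm]
  · simp

lemma nnz_signedSum_le {X : Type} [Fintype X] [DecidableEq X] (m : ℕ) (c : ℝ) :
    nnz (signedSum X m c) ≤ Fintype.card ((X × Fin m) × Bool) := by
  refine nnz_le_card_of_injOn _ (fun x => x.2.1) ?_
  rintro ⟨z, p, a⟩ h ⟨z', p', a'⟩ h' heq
  simp only [Set.mem_ofPred_eq, signedSum, ne_eq, ite_eq_right_iff, Classical.not_imp] at h h'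
  simp only at heq
  grind

/-- The approximate products of two arrays of `m × m` matrices, with `n` sawtooth steps. -/
noncomputable def approxProducts (T : Type) [Fintype T] [DecidableEq T] (m n : ℕ) (R : ℝ)
    (x : (T × Fin m × Fin m) ⊕ (T × Fin m × Fin m) → ℝ) : T × Fin m × Fin m → ℝ :=
  signedSum (T × Fin m × Fin m) m (R ^ 2 / 4 ^ n) *ᵥ
    ((squareStep _)^[n] (squareInit _ (relu (pairSums T m R *ᵥ x + 0))))

lemma abs_approxProducts_sub_le {T : Type} [Fintype T] [DecidableEq T] {m : ℕ} (n : ℕ) {R : ℝ}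
    (hR : 0 < R) (x : (T × Fin m × Fin m) ⊕ (T × Fin m × Fin m) → ℝ) (hx : ∀ z, |x z| ≤ R)
    (t : T) (i j : Fin m) :
    |approxProducts T m n R x (t, i, j) - ∑ l, x (.inl (t, i, l)) * x (.inr (t, l, j))|
      ≤ m * (R ^ 2 / 4 ^ n) := by
  set y : (((T × Fin m × Fin m) × Fin m) × Bool) → ℝ := fun p =>
    (x (.inl (p.1.1.1, p.1.1.2.1, p.1.2))
      + boolSign p.2 * x (.inr (p.1.1.1, p.1.2, p.1.1.2.2))) / (2 * R) with hy
  have hy1 : ∀ p, |y p| ≤ 1 := by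
    rintro ⟨⟨⟨t, i, j⟩, l⟩, s⟩
    rw [hy, abs_div, abs_of_pos (by positivity : 0 < 2 * R), div_le_one (by positivity)]
    have h1 := abs_le.1 (hx (.inl (t, i, l)))
    have h2 := abs_le.1 (hx (.inr (t, l, j)))
    rw [abs_le]
    cases s <;> simp only [boolSign] <;> constructor <;> norm_num <;> linarith
  have hinit : SquareState y 0 (squareInit _ (relu (pairSums T m R *ᵥ x + 0))) := by
    refine squareState_init y hy1 _ ?_
    rintro ⟨⟨⟨t, i, j⟩, l⟩, s⟩
    simp only [relu, add_zero, pairSums_mulVec]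
    rw [hy]
    simp only [boolSign, if_true, one_mul, Bool.false_eq_true, if_false, neg_one_mul (α := ℝ)]
    generalize (_ / (2 * R) : ℝ) = w
    rcases le_total 0 w with h | h
    · rw [abs_of_nonneg h, max_eq_left h, max_eq_right (by linarith)]; ring
    · rw [abs_of_nonpos h, max_eq_right h, max_eq_left (by linarith)]; ring
  have hst := squareState_iterate hinit n
  rw [approxProducts, signedSum_mulVec, ← Finset.sum_sub_distrib]
  refine (Finset.abs_sum_le_sum_abs _ _).trans ?_
  have hm : (m : ℝ) * (R ^ 2 / 4 ^ n) = ∑ _l : Fin m, R ^ 2 / 4 ^ n := by simp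
  rw [hm]
  refine Finset.sum_le_sum fun l _ => ?_
  obtain ⟨u, hu0, hu1, -, -, hu⟩ := hst (((t, i, j), l), true)
  obtain ⟨v, hv0, hv1, -, -, hv⟩ := hst (((t, i, j), l), false)
  rw [hu, hv]
  have hsq : R ^ 2 * (y (((t, i, j), l), true) ^ 2 - y (((t, i, j), l), false) ^ 2)
      = x (.inl (t, i, l)) * x (.inr (t, l, j)) := by
    simp only [hy, boolSign, if_true, Bool.false_eq_true, if_false]
    field_simp
    ring
  have h4 : (0 : ℝ) < 4 ^ n := by positivity
  have key : R ^ 2 / 4 ^ n * (4 ^ n * y (((t, i, j), l), true) ^ 2 + u - u ^ 2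
      - (4 ^ n * y (((t, i, j), l), false) ^ 2 + v - v ^ 2))
      - x (.inl (t, i, l)) * x (.inr (t, l, j))
      = R ^ 2 / 4 ^ n * ((u - u ^ 2) - (v - v ^ 2)) := by
    rw [← hsq]
    field_simp
    ring
  rw [key, abs_mul, abs_of_nonneg (by positivity)]
  refine mul_le_of_le_one_right (by positivity) ?_
  rw [abs_le]
  constructor <;> nlinarith

lemma Realizes.comp_approxProducts {T κ : Type} [Fintype T] [DecidableEq T] [Finite κ] (m n : ℕ)
    (R : ℝ) {f : (T × Fin m × Fin m → ℝ) → (κ → ℝ)} {s : ℕ} (hf : Realizes f s) :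
    ∃ s' ≤ (12 * n + 15) * Fintype.card (((T × Fin m × Fin m) × Fin m) × Bool) + 2 * s,
      Realizes (fun x => f (approxProducts T m n R x)) s' := by
  obtain ⟨s₁, hs₁, h₁⟩ := hf.comp_linear (signedSum (T × Fin m × Fin m) m (R ^ 2 / 4 ^ n))
  obtain ⟨s₂, hs₂, h₂⟩ := h₁.comp_squareStep_iterate n
  obtain ⟨s₃, hs₃, h₃⟩ := h₂.comp_squareInit
  refine ⟨_, ?_, Realizes.layer (pairSums T m R) 0 h₃⟩
  have e1 := nnz_signedSum_le (X := T × Fin m × Fin m) m (R ^ 2 / 4 ^ n)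
  have e2 := nnz_pairSums_le (T := T) m R
  rw [vecNnz_zero]
  nlinarith

/-- The array `u` of coefficients, applied to the `I × I` block structure that
`e : δ → I × Fin m` induces on `δ × δ` matrices. -/
def blockLift {T I δ : Type} {m : ℕ} (e : δ → I × Fin m) (u : T → I → I → ℝ) :
    Matrix (T × Fin m × Fin m) (δ × δ) ℝ :=
  fun z p => if (e p.1).2 = z.2.1 ∧ (e p.2).2 = z.2.2 then u z.1 (e p.1).1 (e p.2).1 else 0

lemma nnz_blockLift_le {T I δ : Type} [Finite T] [Finite I] {m : ℕ}
    {e : δ → I × Fin m} (he : Function.Injective e) (u : T → I → I → ℝ) :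
    nnz (blockLift e u) ≤ Set.ncard {p : T × I × I | u p.1 p.2.1 p.2.2 ≠ 0} * m ^ 2 := by
  have hc : Set.ncard {p : T × I × I | u p.1 p.2.1 p.2.2 ≠ 0} * m ^ 2
      = Set.ncard ({p : T × I × I | u p.1 p.2.1 p.2.2 ≠ 0} ×ˢ
        (Set.univ : Set (Fin m × Fin m))) := by
    rw [Set.ncard_prod, Set.ncard_univ]
    simp [pow_two]
  rw [hc]
  refine Set.ncard_le_ncard_of_injOn
    (fun q => ((q.1.1, (e q.2.1).1, (e q.2.2).1), q.1.2)) ?_ ?_ (Set.toFinite _)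
  · rintro ⟨⟨t, i, j⟩, r, c⟩ h
    simp only [Set.mem_ofPred_eq, blockLift, ne_eq, ite_eq_right_iff, Classical.not_imp] at h
    exact ⟨h.2, Set.mem_univ _⟩
  · rintro ⟨⟨t, i, j⟩, r, c⟩ h ⟨⟨t', i', j'⟩, r', c'⟩ h' heq
    simp only [Set.mem_ofPred_eq, blockLift, ne_eq, ite_eq_right_iff, Classical.not_imp] at h h'
    simp only [Prod.mk.injEq] at heq
    have hr : r = r' := he (Prod.ext (by tauto) (by grind))
    have hcc : c = c' := he (Prod.ext (by tauto) (by grind))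
    simp only [Prod.mk.injEq]
    tauto

lemma abs_blockLift_le_one {T I δ : Type} {m : ℕ} (e : δ → I × Fin m) {u : T → I → I → ℝ}
    (hu : ∀ t a b, |u t a b| ≤ 1) (z : T × Fin m × Fin m) (p : δ × δ) :
    |blockLift e u z p| ≤ 1 := by
  rw [blockLift]
  split_ifs
  · exact hu _ _ _
  · simp

lemma sum_blockLift_mul {T I δ : Type} [Fintype T] [DecidableEq I] [Fintype δ] [DecidableEq δ]
    {m : ℕ} {e : δ → I × Fin m} (he : Function.Injective e) {u v w : T → I → I → ℝ}
    (huvw : ∀ i j a b c f, ∑ t, w t i j * u t a b * v t c f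
      = if a = i ∧ b = c ∧ f = j then 1 else 0)
    (A B : δ × δ → ℝ) (r c : δ) :
    ∑ z : T × Fin m × Fin m, blockLift e w z (r, c) *
        ∑ l, (blockLift e u *ᵥ A) (z.1, z.2.1, l) * (blockLift e v *ᵥ B) (z.1, l, z.2.2)
      = ∑ l, A (r, l) * B (l, c) := by
  have h1 : ∀ p q : δ × δ, ∑ z : T × Fin m × Fin m, ∑ l, blockLift e w z (r, c) *
      (blockLift e u (z.1, z.2.1, l) p * blockLift e v (z.1, l, z.2.2) q)
      = if p.1 = r ∧ p.2 = q.1 ∧ q.2 = c then 1 else 0 := by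
    intro p q
    have h2 : ∀ z : T × Fin m × Fin m, ∑ l, blockLift e w z (r, c) *
        (blockLift e u (z.1, z.2.1, l) p * blockLift e v (z.1, l, z.2.2) q)
        = if (e r).2 = z.2.1 then if (e c).2 = z.2.2 then
          if (e p.1).2 = (e r).2 ∧ (e p.2).2 = (e q.1).2 ∧ (e q.2).2 = (e c).2 then
          w z.1 (e r).1 (e c).1 * u z.1 (e p.1).1 (e p.2).1 * v z.1 (e q.1).1 (e q.2).1
          else 0 else 0 else 0 := by
      intro z
      rw [Finset.sum_eq_single (e p.2).2]
      · simp only [blockLift]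
        split_ifs <;> first | ring1 | grind
      · intro l _ hl
        simp [blockLift, hl.symm]
      · simp
    simp only [h2, Fintype.sum_prod_type, Finset.sum_ite_irrel, Finset.sum_const_zero,
      Finset.sum_ite_eq, Finset.mem_univ, if_true, huvw]
    rw [← ite_and]
    refine if_congr ?_ rfl rfl
    rw [← he.eq_iff (a := p.1), ← he.eq_iff (a := p.2), ← he.eq_iff (a := q.2), Prod.ext_iff,
      Prod.ext_iff, Prod.ext_iff]
    tauto
  calc _ = ∑ z : T × Fin m × Fin m, ∑ l, ∑ p, ∑ q, A p * B q * (blockLift e w z (r, c) *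
      (blockLift e u (z.1, z.2.1, l) p * blockLift e v (z.1, l, z.2.2) q)) := by
        refine Finset.sum_congr rfl fun z _ => ?_
        rw [Finset.mul_sum]
        refine Finset.sum_congr rfl fun l _ => ?_
        simp only [Matrix.mulVec, dotProduct]
        rw [Finset.sum_mul_sum, Finset.mul_sum]
        refine Finset.sum_congr rfl fun p _ => ?_
        rw [Finset.mul_sum]
        exact Finset.sum_congr rfl fun q _ => by ring
    _ = ∑ p, ∑ q, A p * B q * ∑ z : T × Fin m × Fin m, ∑ l, blockLift e w z (r, c) *
      (blockLift e u (z.1, z.2.1, l) p * blockLift e v (z.1, l, z.2.2) q) := by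
        simp only [Finset.mul_sum]
        rw [Finset.sum_congr rfl fun z _ => Finset.sum_comm, Finset.sum_comm]
        refine Finset.sum_congr rfl fun p _ => ?_
        rw [Finset.sum_congr rfl fun z _ => Finset.sum_comm, Finset.sum_comm]
    _ = ∑ l, A (r, l) * B (l, c) := by
        simp only [h1, mul_ite, mul_one, mul_zero, Fintype.sum_prod_type, ite_and,
          Finset.sum_ite_irrel, Finset.sum_const_zero, Finset.sum_ite_eq, Finset.sum_ite_eq',
          Finset.mem_univ, if_true]

/-- The network function computing an approximate matrix product from a bilinear algorithm. -/
noncomputable def approxMatMul {T I δ : Type} [Fintype T] [DecidableEq T] [Fintype δ] {m : ℕ}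
    (e : δ → I × Fin m) (u v w : T → I → I → ℝ) (n : ℕ) (R : ℝ)
    (x : (δ × δ) ⊕ (δ × δ) → ℝ) : δ × δ → ℝ :=
  (blockLift e w)ᵀ *ᵥ approxProducts T m n R
    (Matrix.fromBlocks (blockLift e u) 0 0 (blockLift e v) *ᵥ x) + 0

lemma nnz_fromBlocks_diag_le {κ κ' ι ι' : Type} [Finite κ] [Finite κ'] [Finite ι] [Finite ι']
    (M : Matrix κ ι ℝ) (N : Matrix κ' ι' ℝ) :
    nnz (Matrix.fromBlocks M 0 0 N) ≤ nnz M + nnz N := by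
  have h0 : ∀ α β : Type, nnz (0 : Matrix α β ℝ) = 0 := fun α β => by simp [nnz]
  rw [← Matrix.fromRows_fromCols_eq_fromBlocks]
  have h1 := nnz_fromCols_le M (0 : Matrix κ ι' ℝ)
  have h2 := nnz_fromCols_le (0 : Matrix κ' ι ℝ) N
  have h3 := nnz_fromRows_le (Matrix.fromCols M (0 : Matrix κ ι' ℝ))
    (Matrix.fromCols (0 : Matrix κ' ι ℝ) N)
  rw [h0] at h1 h2
  omega

lemma realizes_approxMatMul {T I δ : Type} [Fintype T] [DecidableEq T] [Fintype I] [Fintype δ]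
    {m s : ℕ} {e : δ → I × Fin m} (he : Function.Injective e) {u v w : T → I → I → ℝ}
    (hu : Set.ncard {p : T × I × I | u p.1 p.2.1 p.2.2 ≠ 0} ≤ s)
    (hv : Set.ncard {p : T × I × I | v p.1 p.2.1 p.2.2 ≠ 0} ≤ s)
    (hw : Set.ncard {p : T × I × I | w p.1 p.2.1 p.2.2 ≠ 0} ≤ s) (n : ℕ) (R : ℝ) :
    ∃ s' ≤ 8 * (s * m ^ 2) + (48 * n + 60) * (Fintype.card T * m ^ 3),
      Realizes (approxMatMul e u v w n R) s' := by
  have hu' := (nnz_blockLift_le he u).trans (Nat.mul_le_mul_right (m ^ 2) hu)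
  have hv' := (nnz_blockLift_le he v).trans (Nat.mul_le_mul_right (m ^ 2) hv)
  have hw' := (nnz_blockLift_le he w).trans (Nat.mul_le_mul_right (m ^ 2) hw)
  rw [← nnz_transpose] at hw'
  obtain ⟨s₁, hs₁, h₁⟩ := (Realizes.last (blockLift e w)ᵀ 0).comp_approxProducts m n R
  obtain ⟨s₂, hs₂, h₂⟩ := h₁.comp_linear
    (Matrix.fromBlocks (blockLift e u) 0 0 (blockLift e v))
  refine ⟨s₂, ?_, h₂⟩
  have hb := nnz_fromBlocks_diag_le (blockLift e u) (blockLift e v)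
  rw [vecNnz_zero] at hs₁
  simp only [Fintype.card_prod, Fintype.card_fin, Fintype.card_bool] at hs₁
  have hP : (12 * n + 15) * (Fintype.card T * (m * m) * m * 2)
      = (24 * n + 30) * (Fintype.card T * m ^ 3) := by ring
  rw [hP] at hs₁
  have h2 : (48 * n + 60) * (Fintype.card T * m ^ 3)
    = 2 * ((24 * n + 30) * (Fintype.card T * m ^ 3)) := by ring
  omega

lemma abs_approxMatMul_sub_le {T I δ : Type} [Fintype T] [DecidableEq T] [DecidableEq I]
    [Fintype δ] [DecidableEq δ] {m : ℕ} {e : δ → I × Fin m} (he : Function.Injective e)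
    {u v w : T → I → I → ℝ}
    (huvw : ∀ i j a b c f, ∑ t, w t i j * u t a b * v t c f
      = if a = i ∧ b = c ∧ f = j then 1 else 0)
    (hu : ∀ t a b, |u t a b| ≤ 1) (hv : ∀ t a b, |v t a b| ≤ 1) (hw : ∀ t a b, |w t a b| ≤ 1)
    (n : ℕ) {x : (δ × δ) ⊕ (δ × δ) → ℝ} (hx : ∀ p, |x p| ≤ 1) (r c : δ) :
    |approxMatMul e u v w n ((Fintype.card δ : ℝ) ^ 2) x (r, c)
        - ∑ l, x (.inl (r, l)) * x (.inr (l, c))|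
      ≤ Fintype.card T * m ^ 3 * ((Fintype.card δ : ℝ) ^ 4 / 4 ^ n) := by
  set R : ℝ := (Fintype.card δ : ℝ) ^ 2 with hR
  have hRpos : 0 < R := by
    have : 0 < Fintype.card δ := Fintype.card_pos_iff.2 ⟨r⟩
    positivity
  set y := Matrix.fromBlocks (blockLift e u) 0 0 (blockLift e v) *ᵥ x with hy
  have hyl : ∀ z, y (.inl z) = (blockLift e u *ᵥ fun p => x (.inl p)) z := fun z => by
    rw [hy, Matrix.fromBlocks_mulVec]
    simp [Function.comp_def]
  have hyr : ∀ z, y (.inr z) = (blockLift e v *ᵥ fun p => x (.inr p)) z := fun z => by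
    rw [hy, Matrix.fromBlocks_mulVec]
    simp [Function.comp_def]
  have hbound : ∀ (q : T → I → I → ℝ), (∀ t a b, |q t a b| ≤ 1) → ∀ (A : δ × δ → ℝ),
      (∀ p, |A p| ≤ 1) → ∀ z, |(blockLift e q *ᵥ A) z| ≤ R := by
    intro q hq A hA z
    refine (Finset.abs_sum_le_sum_abs _ _).trans ?_
    have hc : R = ∑ _p : δ × δ, (1 : ℝ) := by simp [hR, pow_two]
    rw [hc]
    refine Finset.sum_le_sum fun p _ => ?_
    rw [abs_mul]
    exact mul_le_one₀ (abs_blockLift_le_one e hq z p) (abs_nonneg _) (hA p)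
  have hyR : ∀ z, |y z| ≤ R := by
    rintro (z | z)
    · rw [hyl]; exact hbound u hu _ (fun p => hx _) z
    · rw [hyr]; exact hbound v hv _ (fun p => hx _) z
  have hex := sum_blockLift_mul he huvw (fun p => x (.inl p)) (fun p => x (.inr p)) r c
  rw [← hex]
  simp only [← hyl, ← hyr]
  have hout : approxMatMul e u v w n R x (r, c)
      = ∑ z, blockLift e w z (r, c) * approxProducts T m n R y z := by
    simp [approxMatMul, Matrix.mulVec, dotProduct, hy]
  rw [hout, ← Finset.sum_sub_distrib]
  refine (Finset.abs_sum_le_sum_abs _ _).trans ?_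
  have hcard : Fintype.card T * (m : ℝ) ^ 3 * ((Fintype.card δ : ℝ) ^ 4 / 4 ^ n)
      = ∑ _z : T × Fin m × Fin m, (m : ℝ) * (R ^ 2 / 4 ^ n) := by
    simp [hR]
    ring
  rw [hcard]
  refine Finset.sum_le_sum fun z _ => ?_
  rw [← mul_sub, abs_mul]
  exact (mul_le_of_le_one_left (abs_nonneg _) (abs_blockLift_le_one e hw z _)).trans
    (abs_approxProducts_sub_le n hRpos y hyR z.1 z.2.1 z.2.2)

lemma succ_mul_seven_pow_le (k : ℕ) : (k + 1) * 7 ^ k ≤ 7 * 8 ^ k := by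
  have h : ∀ k : ℕ, (k + 7) * 7 ^ k ≤ 7 * 8 ^ k := by
    intro k
    induction k with
    | zero => simp
    | succ k ih =>
      have : (0 : ℕ) < 7 ^ k := by positivity
      rw [pow_succ, pow_succ]
      nlinarith
  exact (Nat.mul_le_mul_right _ (by omega)).trans (h k)

/-- **Approximate matrix multiplication by ReLU networks.** There is a constant `C > 0`
such that for every dimension `d` and every `ε ∈ (0, 1/2)` there is a ReLU network
`Φ : ℝ^{d×d} × ℝ^{d×d} → ℝ^{d×d}` of size at most `C · d³ · log₂(1/ε)` approximating
the matrix product entrywise up to `ε` on matrices with entries bounded by `1`. -/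
theorem relu_matrix_multiplication_approx :
    ∃ C : ℝ, 0 < C ∧
      ∀ d : ℕ, ∀ ε : ℝ, ε ∈ Set.Ioo (0 : ℝ) (1 / 2) →
        ∃ Φ : ReLUNet (d * d + d * d) (d * d),
          (Φ.size : ℝ) ≤ C * (d : ℝ) ^ 3 * Real.logb 2 (1 / ε) ∧
          ∀ A B : Matrix (Fin d) (Fin d) ℝ,
            (∀ i j, |A i j| ≤ 1) → (∀ i j, |B i j| ≤ 1) →
            ∀ i j,
              |vecToMat (Φ.eval (Fin.append (matToVec A) (matToVec B))) i j
                - (A * B) i j| ≤ ε := by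
  refine ⟨100000, by norm_num, fun d ε ⟨hε0, hε1⟩ => ?_⟩
  rcases Nat.eq_zero_or_pos d with rfl | hd
  · refine ⟨.last 0 0, ?_, fun A B _ _ i => i.elim0⟩
    simp [ReLUNet.size]
  set L := Real.logb 2 (1 / ε) with hL
  have hL1 : 1 ≤ L := by
    rw [hL, Real.le_logb_iff_rpow_le (by norm_num) (by positivity), Real.rpow_one,
      le_div_iff₀ hε0]
    linarith
  obtain ⟨k, hk1, hk2⟩ : ∃ k, 4 ^ k ≤ d ∧ d < 4 ^ (k + 1) :=
    ⟨Nat.log 4 d, Nat.pow_log_le_self 4 hd.ne', Nat.lt_pow_succ_log_self (by norm_num) d⟩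
  set m := d / 2 ^ k + 1 with hm
  have hdm : d ≤ 2 ^ k * m := (Nat.lt_mul_div_succ d (by positivity)).le
  have hmd : 2 ^ k * m ≤ 2 * d := by
    have h1 := Nat.mul_div_le d (2 ^ k)
    have h2 : 2 ^ k ≤ 4 ^ k := Nat.pow_le_pow_left (by norm_num) k
    rw [hm, mul_add, mul_one]
    omega
  obtain ⟨e⟩ : Nonempty (Fin d ↪ (Fin k → Fin 2) × Fin m) :=
    Function.Embedding.nonempty_of_card_le (by simpa using hdm)
  set q := ⌈L⌉₊ with hq
  have hqL : (q : ℝ) ≤ 2 * L := by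
    have := Nat.ceil_lt_add_one (by linarith : 0 ≤ L)
    linarith
  have hqε : 1 / ε ≤ 4 ^ q := by
    have h1 : L ≤ q := Nat.le_ceil L
    rw [hL, Real.logb_le_iff_le_rpow (by norm_num) (by positivity), Real.rpow_natCast] at h1
    exact h1.trans (pow_le_pow_left₀ (by norm_num) (by norm_num) q)
  set n := 9 * (k + 1) + q with hn
  have hm3 : (2 ^ k * m) ^ 3 ≤ 8 * d ^ 3 := by
    calc (2 ^ k * m) ^ 3 ≤ (2 * d) ^ 3 := Nat.pow_le_pow_left hmd 3
      _ = 8 * d ^ 3 := by ring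
  have h8 : (2 ^ k * m) ^ 3 = 8 ^ k * m ^ 3 := by
    rw [mul_pow, ← pow_mul, mul_comm k 3, pow_mul]; norm_num
  have hcount : (k + 1) * (7 ^ k * m ^ 3) ≤ 56 * d ^ 3 := by
    calc (k + 1) * (7 ^ k * m ^ 3) = (k + 1) * 7 ^ k * m ^ 3 := by ring
      _ ≤ 7 * 8 ^ k * m ^ 3 := Nat.mul_le_mul_right _ (succ_mul_seven_pow_le k)
      _ = 7 * (2 ^ k * m) ^ 3 := by rw [h8]; ring
      _ ≤ 56 * d ^ 3 := by omega
  have hlin : 12 ^ k * m ^ 2 ≤ 4 * d ^ 3 := by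
    calc 12 ^ k * m ^ 2 = 3 ^ k * (2 ^ k * m) ^ 2 := by
          rw [mul_pow, ← pow_mul, mul_comm k 2, pow_mul, ← mul_assoc, ← mul_pow]; norm_num
      _ ≤ d * (2 * d) ^ 2 := Nat.mul_le_mul
          ((Nat.pow_le_pow_left (by norm_num) k).trans hk1) (Nat.pow_le_pow_left hmd 2)
      _ = 4 * d ^ 3 := by ring
  obtain ⟨s, hs, hreal⟩ := realizes_approxMatMul e.injective
    (ncard_tensorPow_support_le card_strassenLeft_support k)
    (ncard_tensorPow_support_le card_strassenRight_support k)
    (ncard_tensorPow_support_le card_strassenOut_support k) n ((Fintype.card (Fin d) : ℝ) ^ 2)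
  obtain ⟨Φ, hΦs, hΦ⟩ := hreal.exists_net
    ((finProdFinEquiv.sumCongr finProdFinEquiv).trans finSumFinEquiv)
    (finProdFinEquiv (m := d) (n := d))
  refine ⟨Φ, ?_, fun A B hA hB i j => ?_⟩
  · simp only [Fintype.card_pi, Fintype.card_fin, Finset.prod_const, Finset.card_univ] at hs
    have hsR : (Φ.size : ℝ) ≤ 8 * (12 ^ k * m ^ 2) + (48 * n + 60) * (7 ^ k * m ^ 3) := by
      exact_mod_cast hΦs.trans hs
    have hlinR : (12 : ℝ) ^ k * m ^ 2 ≤ 4 * d ^ 3 := by exact_mod_cast hlin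
    have hcountR : ((k : ℝ) + 1) * (7 ^ k * m ^ 3) ≤ 56 * d ^ 3 := by exact_mod_cast hcount
    have hk0 : (0 : ℝ) ≤ k := k.cast_nonneg
    have hnR : (48 * n + 60 : ℝ) ≤ 588 * ((k + 1) * L) := by
      rw [hn]
      push_cast
      nlinarith
    have hd0 : (0 : ℝ) ≤ (d : ℝ) ^ 3 := by positivity
    calc (Φ.size : ℝ) ≤ 8 * (12 ^ k * m ^ 2) + (48 * n + 60) * (7 ^ k * m ^ 3) := hsR
      _ ≤ 8 * (4 * d ^ 3) + 588 * ((k + 1) * L) * (7 ^ k * m ^ 3) := by gcongr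
      _ = 32 * d ^ 3 + 588 * L * (((k : ℝ) + 1) * (7 ^ k * m ^ 3)) := by ring
      _ ≤ 32 * d ^ 3 + 588 * L * (56 * d ^ 3) := by gcongr
      _ ≤ 100000 * d ^ 3 * L := by nlinarith
  · set x : (Fin d × Fin d) ⊕ (Fin d × Fin d) → ℝ :=
      Sum.elim (fun p => A p.1 p.2) (fun p => B p.1 p.2) with hx
    have hin : Fin.append (matToVec A) (matToVec B)
        = x ∘ ((finProdFinEquiv.sumCongr finProdFinEquiv).trans finSumFinEquiv).symm := by
      funext a
      refine Fin.addCases (fun a => ?_) (fun a => ?_) a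
      · simp [hx, matToVec]
      · rw [Fin.append_right, Function.comp_apply, Equiv.symm_trans_apply,
          finSumFinEquiv_symm_apply_natAdd]
        simp [hx, matToVec]
    have herr := abs_approxMatMul_sub_le e.injective (strassen_tensorPow_identity k)
      (abs_tensorPow_le_one abs_strassenLeft_le_one k)
      (abs_tensorPow_le_one abs_strassenRight_le_one k)
      (abs_tensorPow_le_one abs_strassenOut_le_one k) n (x := x)
      (by rintro (p | p); exacts [hA _ _, hB _ _]) i j
    have hval : vecToMat (Φ.eval (Fin.append (matToVec A) (matToVec B))) i j
        = approxMatMul e (tensorPow strassenLeft k) (tensorPow strassenRight k)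
          (tensorPow strassenOut k) n ((Fintype.card (Fin d) : ℝ) ^ 2) x (i, j) := by
      rw [hin, hΦ]
      simp [vecToMat]
    rw [hval, Matrix.mul_apply]
    refine herr.trans ?_
    simp only [Fintype.card_pi, Fintype.card_fin, Finset.prod_const, Finset.card_univ,
      Nat.cast_pow, Nat.cast_ofNat]
    have h7 : (7 : ℝ) ^ k * m ^ 3 ≤ 8 * d ^ 3 := by
      have h78 : 7 ^ k * m ^ 3 ≤ 8 * d ^ 3 :=
        (Nat.mul_le_mul_right _ (Nat.pow_le_pow_left (by norm_num) k)).trans (h8 ▸ hm3)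
      exact_mod_cast h78
    have hd4 : (d : ℝ) ≤ 4 ^ (k + 1) := by exact_mod_cast hk2.le
    have h16 : (8 : ℝ) ≤ (4 ^ (k + 1)) ^ 2 := by
      have h1 : (1 : ℝ) ≤ 4 ^ k := one_le_pow₀ (by norm_num)
      have h2 : (4 : ℝ) ≤ 4 ^ (k + 1) := by rw [pow_succ]; linarith
      nlinarith
    have hpoly : (8 : ℝ) * d ^ 3 * d ^ 4 ≤ 4 ^ (9 * (k + 1)) := by
      calc (8 : ℝ) * d ^ 3 * d ^ 4 = 8 * d ^ 7 := by ring
        _ ≤ (4 ^ (k + 1)) ^ 2 * (4 ^ (k + 1)) ^ 7 := by gcongr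
        _ = 4 ^ (9 * (k + 1)) := by rw [← pow_add, ← pow_mul, mul_comm]
    have h4n : (0 : ℝ) < 4 ^ n := by positivity
    rw [← mul_div_assoc, div_le_iff₀ h4n]
    calc (7 : ℝ) ^ k * m ^ 3 * d ^ 4 ≤ 8 * d ^ 3 * d ^ 4 := by gcongr
      _ ≤ 4 ^ (9 * (k + 1)) := hpoly
      _ ≤ 4 ^ (9 * (k + 1)) * (ε * 4 ^ q) := by
        refine le_mul_of_one_le_right (by positivity) ?_
        rwa [div_le_iff₀' hε0] at hqε
      _ = ε * 4 ^ n := by rw [hn, pow_add]; ring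
end

section
/- There exists a constant q > 0 such that for every δ ∈ (0,1) there is a constant C(δ) > 0 with the following property: for all d ∈ ℕ and every ε ∈ (0, 1/2) there is a ReLU neural network Φ : ℝ^{d×d} → ℝ^{d×d} of size at most C(δ) · d³ · log₂^q(1/ε) such that for every matrix B ∈ ℝ^{d×d} with ‖Id − B‖₂ ≤ 1 − δ, the matrix B is invertible and ‖ Φ(B) − B^{-1} ‖₂ ≤ ε. -/
/-- The spectral norm (Euclidean operator norm) of a real `d × d` matrix. -/
noncomputable def specNorm {d : ℕ} (A : Matrix (Fin d) (Fin d) ℝ) : ℝ :=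
  ‖LinearMap.toContinuousLinearMap (Matrix.toEuclideanLin A)‖

namespace ReLUNet

open Finset

/-- Affine functionals written with at most `n` terms. -/
inductive SparseAffine {ι : Type} : ℕ → ((ι → ℝ) → ℝ) → Prop
  | zero : SparseAffine 0 (fun _ => 0)
  | add_const {n : ℕ} {φ : (ι → ℝ) → ℝ} (c : ℝ) (h : SparseAffine n φ) :
      SparseAffine (n + 1) (fun x => φ x + c)
  | add_term {n : ℕ} {φ : (ι → ℝ) → ℝ} (c : ℝ) (i : ι) (h : SparseAffine n φ) :
      SparseAffine (n + 1) (fun x => φ x + c * x i)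

/-- The indicator of `r ≠ 0`. -/
noncomputable def nz (r : ℝ) : ℕ := if r = 0 then 0 else 1

@[simp] theorem nz_zero : nz 0 = 0 := by simp [nz]

@[simp] theorem nz_neg (r : ℝ) : nz (-r) = nz r := by simp [nz]

theorem nz_le_one (r : ℝ) : nz r ≤ 1 := by unfold nz; split_ifs <;> simp

theorem nz_add_le (r s : ℝ) : nz (r + s) ≤ nz r + nz s := by
  unfold nz
  split_ifs <;> simp_all

theorem ncard_ne_zero_eq_sum {α : Type} [Fintype α] (f : α → ℝ) :
    Set.ncard {a | f a ≠ 0} = ∑ a, nz (f a) := by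
  classical
  rw [Set.ncard_eq_toFinset_card', Set.toFinset_ofPred, Finset.card_filter]
  refine Finset.sum_congr rfl fun a _ => ?_
  by_cases h : f a = 0 <;> simp [nz, h]

namespace SparseAffine

variable {ι κ : Type} {n m : ℕ} {φ ψ : (ι → ℝ) → ℝ}

theorem mono (h : SparseAffine n φ) (hnm : n ≤ m) : SparseAffine m φ := by
  induction hnm with
  | refl => exact h
  | step _ ih => simpa using ih.add_const 0

theorem add (h : SparseAffine n φ) (h' : SparseAffine m ψ) :
    SparseAffine (n + m) (fun x => φ x + ψ x) := by
  induction h' with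
  | zero => simpa using h
  | add_const c _ ih => simpa [add_assoc] using ih.add_const c
  | add_term c i _ ih => simpa [add_assoc] using ih.add_term c i

theorem const (c : ℝ) : SparseAffine 1 (fun _ : ι → ℝ => c) := by
  simpa using (zero (ι := ι)).add_const c

theorem term (c : ℝ) (i : ι) : SparseAffine 1 (fun x : ι → ℝ => c * x i) := by
  simpa using (zero (ι := ι)).add_term c i

theorem proj (i : ι) : SparseAffine 1 (fun x : ι → ℝ => x i) := by
  simpa using term 1 i

theorem sum {α : Type} (s : Finset α) {φ : α → (ι → ℝ) → ℝ} (h : ∀ a, SparseAffine n (φ a)) :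
    SparseAffine (s.card * n) (fun x => ∑ a ∈ s, φ a x) := by
  classical
  induction s using Finset.induction_on with
  | empty => simpa using zero
  | insert a s ha ih =>
    simp only [Finset.sum_insert ha, Finset.card_insert_of_notMem ha]
    exact ((h a).add ih).mono (by lia)

theorem comp (h : SparseAffine n φ) (e : ι → κ) :
    SparseAffine n (fun x : κ → ℝ => φ (fun i => x (e i))) := by
  induction h with
  | zero => exact zero
  | add_const c _ ih => exact ih.add_const c
  | add_term c i _ ih => exact ih.add_term c (e i)

theorem exists_coeff [Fintype ι] (h : SparseAffine n φ) :
    ∃ (a : ι → ℝ) (b : ℝ), ∑ i, nz (a i) + nz b ≤ n ∧ ∀ x, φ x = ∑ i, a i * x i + b := by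
  classical
  induction h with
  | zero => exact ⟨0, 0, by simp, by simp⟩
  | add_const c _ ih =>
    obtain ⟨a, b, hn, hx⟩ := ih
    refine ⟨a, b + c, ?_, fun x => by simp only [hx]; ring⟩
    have := nz_add_le b c
    have := nz_le_one c
    lia
  | add_term c i _ ih =>
    obtain ⟨a, b, hn, hx⟩ := ih
    refine ⟨fun j => a j + if j = i then c else 0, b, ?_, fun x => ?_⟩
    · have h1 : ∑ j, nz (a j + if j = i then c else 0)
          ≤ ∑ j, (nz (a j) + if j = i then 1 else 0) := by
        refine Finset.sum_le_sum fun j _ => ?_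
        split_ifs
        · exact (nz_add_le _ _).trans (by gcongr; exact nz_le_one c)
        · simp
      rw [Finset.sum_add_distrib] at h1
      simp only [Finset.sum_ite_eq', Finset.mem_univ, if_true] at h1
      lia
    · simp [hx, add_mul, Finset.sum_add_distrib]
      ring

end SparseAffine

/-- A sparse affine functional, possibly followed by a ReLU. -/
def IsGate {ι : Type} (n : ℕ) (φ : (ι → ℝ) → ℝ) : Prop :=
  SparseAffine n φ ∨ ∃ ψ, SparseAffine n ψ ∧ φ = fun x => max (ψ x) 0

theorem IsGate.comp {ι κ : Type} {n : ℕ} {φ : (ι → ℝ) → ℝ} (h : IsGate n φ) (e : ι → κ) :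
    IsGate n (fun x : κ → ℝ => φ (fun i => x (e i))) := by
  rcases h with h | ⟨ψ, h, rfl⟩
  · exact Or.inl (h.comp e)
  · exact Or.inr ⟨_, h.comp e, rfl⟩

/-- A layer all of whose outputs are gates, with at most `w` terms in total. -/
def IsLayer {ι κ : Type} [Fintype κ] (w : ℕ) (g : (ι → ℝ) → (κ → ℝ)) : Prop :=
  ∃ c : κ → ℕ, (∀ k, IsGate (c k) fun x => g x k) ∧ ∑ k, c k ≤ w

theorem IsLayer.of_affine {ι κ : Type} [Fintype κ] {w : ℕ} {g : (ι → ℝ) → (κ → ℝ)} (n : ℕ)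
    (h : ∀ k, SparseAffine n fun x => g x k) (hw : Fintype.card κ * n ≤ w) : IsLayer w g :=
  ⟨fun _ => n, fun k => Or.inl (h k), by simpa using hw⟩

/-- Compositions of `L` layers with at most `w` terms each. -/
inductive Chain (w : ℕ) : (ι κ : Type) → ℕ → ((ι → ℝ) → (κ → ℝ)) → Prop
  | refl (ι : Type) : Chain w ι ι 0 id
  | cons {ι κ μ : Type} [Fintype κ] {L : ℕ} {g : (ι → ℝ) → (κ → ℝ)} {f : (κ → ℝ) → (μ → ℝ)}
      (hg : IsLayer w g) (hf : Chain w κ μ L f) : Chain w ι μ (L + 1) (f ∘ g)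

namespace Chain

variable {ι κ μ : Type} {w w' L L' : ℕ} {f : (ι → ℝ) → (κ → ℝ)} {g : (κ → ℝ) → (μ → ℝ)}

theorem mono (h : Chain w ι κ L f) (hw : w ≤ w') : Chain w' ι κ L f := by
  induction h with
  | refl ι => exact refl ι
  | cons hg _ ih =>
    obtain ⟨c, hc, hs⟩ := hg
    exact cons ⟨c, hc, hs.trans hw⟩ ih

theorem comp (hf : Chain w ι κ L f) (hg : Chain w κ μ L' g) :
    Chain w ι μ (L + L') (g ∘ f) := by
  induction hf with
  | refl ι => simpa using hg
  | cons h _ ih =>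
    have := cons h (ih hg)
    rwa [show ∀ a b : ℕ, a + 1 + b = a + b + 1 by lia]

theorem single [Fintype κ] (h : IsLayer w f) : Chain w ι κ 1 f := cons (f := id) h (refl κ)

theorem iterate {f : (ι → ℝ) → (ι → ℝ)} (h : Chain w ι ι L f) (m : ℕ) :
    Chain w ι ι (m * L) f^[m] := by
  induction m with
  | zero => simpa using refl ι
  | succ m ih =>
    rw [Function.iterate_succ', add_mul, one_mul]
    exact ih.comp h

/-- Independent copies of a chain, run in parallel. -/
theorem parallel (α : Type) [Fintype α] (h : Chain w ι κ L f) :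
    Chain (Fintype.card α * w) (α × ι) (α × κ) L (fun x p => f (fun i => x (p.1, i)) p.2) := by
  induction h with
  | refl ι => exact refl _
  | @cons ι κ μ _ L g f hg _ ih =>
    obtain ⟨c, hc, hs⟩ := hg
    refine cons (g := fun x p => g (fun i => x (p.1, i)) p.2)
      ⟨fun p => c p.2, fun p => (hc p.2).comp fun i => (p.1, i), ?_⟩ ih
    rw [Fintype.sum_prod_type]
    simpa using Nat.mul_le_mul_left _ hs

/-- A chain that also passes some coordinates through unchanged. -/
theorem carry (γ : Type) [Fintype γ] (h : Chain w ι κ L f) :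
    Chain (w + Fintype.card γ) (ι ⊕ γ) (κ ⊕ γ) L
      (fun x => Sum.elim (f fun i => x (Sum.inl i)) fun c => x (Sum.inr c)) := by
  induction h with
  | refl ι =>
    convert refl (w := w + Fintype.card γ) (ι ⊕ γ) using 1
    ext x (i | c) <;> rfl
  | @cons ι κ μ _ L g f hg _ ih =>
    obtain ⟨c, hc, hs⟩ := hg
    refine cons (g := fun x => Sum.elim (g fun i => x (Sum.inl i)) fun c => x (Sum.inr c))
      ⟨Sum.elim c fun _ => 1, ?_, by simpa using hs⟩ ih
    rintro (k | k)
    · exact (hc k).comp Sum.inl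
    · exact Or.inl (SparseAffine.proj _)

end Chain

theorem IsLayer.exists_coeff {ι κ : Type} [Fintype ι] [Fintype κ] {w : ℕ}
    {g : (ι → ℝ) → (κ → ℝ)} (h : IsLayer w g) :
    ∃ (W : κ → ι → ℝ) (b : κ → ℝ) (s : κ → Bool),
      ∑ k, ∑ i, nz (W k i) + ∑ k, nz (b k) ≤ w ∧
      ∀ x k, g x k = if s k then max (∑ i, W k i * x i + b k) 0 else ∑ i, W k i * x i + b k := by
  obtain ⟨c, hc, hs⟩ := h
  have key : ∀ k, ∃ (a : ι → ℝ) (b : ℝ) (s : Bool), ∑ i, nz (a i) + nz b ≤ c k ∧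
      ∀ x, g x k = if s then max (∑ i, a i * x i + b) 0 else ∑ i, a i * x i + b := by
    intro k
    rcases hc k with h | ⟨ψ, h, hψ⟩
    · obtain ⟨a, b, hn, hx⟩ := h.exists_coeff
      exact ⟨a, b, false, hn, by simpa using hx⟩
    · obtain ⟨a, b, hn, hx⟩ := h.exists_coeff
      exact ⟨a, b, true, hn, fun x => by simpa [hx] using congrFun hψ x⟩
  choose W b s hn hx using key
  refine ⟨W, b, s, ?_, fun x k => hx k x⟩
  rw [← Finset.sum_add_distrib]
  exact (Finset.sum_le_sum fun k _ => hn k).trans hs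

/-- Weights `W` acting on the pair of positive and negative parts of the input and producing the
positive and negative parts of the output; the latter vanish where `s` holds. -/
def splitWeight {ι κ : Type} (W : κ → ι → ℝ) (s : κ → Bool) : κ ⊕ κ → ι ⊕ ι → ℝ
  | Sum.inl k, Sum.inl i => W k i
  | Sum.inl k, Sum.inr i => -W k i
  | Sum.inr k, Sum.inl i => if s k then 0 else -W k i
  | Sum.inr k, Sum.inr i => if s k then 0 else W k i

/-- The bias accompanying `splitWeight`. -/
def splitBias {κ : Type} (b : κ → ℝ) (s : κ → Bool) : κ ⊕ κ → ℝ
  | Sum.inl k => b k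
  | Sum.inr k => if s k then 0 else -b k

theorem nz_ite_zero_le (p : Prop) [Decidable p] (r : ℝ) : nz (if p then 0 else r) ≤ nz r := by
  split_ifs <;> simp

theorem sum_nz_split_le {ι κ : Type} [Fintype ι] [Fintype κ] (W : κ → ι → ℝ) (b : κ → ℝ)
    (s : κ → Bool) :
    ∑ q, ∑ p, nz (splitWeight W s q p) + ∑ q, nz (splitBias b s q)
      ≤ 4 * (∑ k, ∑ i, nz (W k i) + ∑ k, nz (b k)) := by
  have h1 : ∀ k i, nz (if s k then 0 else -W k i) ≤ nz (W k i) := fun k i =>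
    (nz_ite_zero_le _ _).trans (nz_neg _).le
  have h2 : ∀ k i, nz (if s k then 0 else W k i) ≤ nz (W k i) := fun k i => nz_ite_zero_le _ _
  have h3 : ∀ k, nz (if s k then 0 else -b k) ≤ nz (b k) := fun k =>
    (nz_ite_zero_le _ _).trans (nz_neg _).le
  have e1 := Finset.sum_le_sum fun k (_ : k ∈ univ) =>
    Finset.sum_le_sum fun i (_ : i ∈ univ) => h1 k i
  have e2 := Finset.sum_le_sum fun k (_ : k ∈ univ) =>
    Finset.sum_le_sum fun i (_ : i ∈ univ) => h2 k i
  have e3 := Finset.sum_le_sum fun k (_ : k ∈ univ) => h3 k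
  simp only [Fintype.sum_sum_type, splitWeight, splitBias, Finset.sum_add_distrib, nz_neg]
  lia

theorem split_eval {ι κ : Type} [Fintype ι] (W : κ → ι → ℝ) (b : κ → ℝ)
    (s : κ → Bool) (y : ι ⊕ ι → ℝ) (k : κ) :
    max (∑ p, splitWeight W s (Sum.inl k) p * y p + splitBias b s (Sum.inl k)) 0
      - max (∑ p, splitWeight W s (Sum.inr k) p * y p + splitBias b s (Sum.inr k)) 0
    = if s k then max (∑ i, W k i * (y (Sum.inl i) - y (Sum.inr i)) + b k) 0
      else ∑ i, W k i * (y (Sum.inl i) - y (Sum.inr i)) + b k := by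
  simp only [Fintype.sum_sum_type, splitWeight, splitBias, mul_sub, Finset.sum_sub_distrib]
  cases s k
  · simp only [neg_mul, Finset.sum_neg_distrib, Bool.false_eq_true, if_false]
    generalize ∑ i, W k i * y (Sum.inl i) = u
    generalize ∑ i, W k i * y (Sum.inr i) = v
    rw [show -u + v + -b k = -(u + -v + b k) by ring, max_zero_sub_max_neg_zero_eq_self]
    ring
  · simp [sub_eq_add_neg]

/-- Size of a layer with entries transported along bijections to `Fin`. -/
theorem ncard_layer_eq {α β : Type} [Fintype α] [Fintype β] {n m : ℕ} (e : Fin n ≃ α)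
    (e' : Fin m ≃ β) (W : β → α → ℝ) (b : β → ℝ) :
    Set.ncard {p : Fin m × Fin n | (Matrix.of fun q p => W (e' q) (e p)) p.1 p.2 ≠ 0}
      + Set.ncard {q : Fin m | b (e' q) ≠ 0} = ∑ q, ∑ p, nz (W q p) + ∑ q, nz (b q) := by
  rw [ncard_ne_zero_eq_sum fun p : Fin m × Fin n => Matrix.of (fun q p => W (e' q) (e p)) p.1 p.2,
    ncard_ne_zero_eq_sum fun q => b (e' q), Fintype.sum_prod_type]
  simp only [Matrix.of_apply]
  rw [e'.sum_comp fun q => nz (b q), e'.sum_comp fun q => ∑ p, nz (W q (e p))]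
  congr 1
  exact Finset.sum_congr rfl fun q _ => e.sum_comp fun p => nz (W q p)

theorem mulVec_reindex {α β : Type} [Fintype α] {n m : ℕ} (e : Fin n ≃ α)
    (e' : Fin m ≃ β) (W : β → α → ℝ) (b : β → ℝ) (x : α → ℝ) (q : Fin m) :
    ((Matrix.of fun q p => W (e' q) (e p)).mulVec (x ∘ e) + (b ∘ e')) q
      = ∑ p, W (e' q) p * x p + b (e' q) := by
  simp only [Pi.add_apply, Matrix.mulVec, dotProduct, Matrix.of_apply, Function.comp]
  rw [e.sum_comp fun p => W (e' q) p * x p]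

theorem Chain.exists_net_split {ι κ : Type} {w L : ℕ} {f : (ι → ℝ) → (κ → ℝ)}
    (h : Chain w ι κ L f) : ∀ [Fintype ι] {n m : ℕ} (e : Fin n ≃ ι ⊕ ι) (e' : Fin m ≃ κ),
    ∃ N : ReLUNet n m, N.size ≤ L * (4 * w) + 2 * m ∧
      ∀ y : ι ⊕ ι → ℝ, N.eval (y ∘ e) = f (fun i => y (Sum.inl i) - y (Sum.inr i)) ∘ e' := by
  classical
  induction h with
  | refl ι =>
    intro _ n m e e'
    let W : ι → ι ⊕ ι → ℝ := fun k => Sum.elim (Pi.single k 1) (-Pi.single k 1)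
    refine ⟨last (Matrix.of fun q p => W (e' q) (e p)) ((fun _ => 0) ∘ e'), ?_, fun y => ?_⟩
    · have hm : m = Fintype.card ι := by simpa using Fintype.card_congr e'
      have hz : ∀ k, ∑ i, nz ((Pi.single k 1 : ι → ℝ) i) = 1 := fun k => by
        simp [Pi.single_apply, nz]
      simp only [size, Function.comp]
      rw [ncard_layer_eq e e' W fun _ => 0]
      simp only [W, Fintype.sum_sum_type, Sum.elim_inl, Sum.elim_inr, Pi.neg_apply, nz_neg, hz]
      simp [hm, mul_comm]
    · funext q
      rw [eval, mulVec_reindex e e' W]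
      simp [W, Pi.single_apply, sub_eq_add_neg]
  | @cons ι κ μ _ L g f hg _ ih =>
    intro _ n m e e'
    obtain ⟨W, b, s, hs, hx⟩ := hg.exists_coeff
    let e'' := (Fintype.equivFin (κ ⊕ κ)).symm
    obtain ⟨N, hN, hev⟩ := ih e'' e'
    refine ⟨layer (Matrix.of fun q p => splitWeight W s (e'' q) (e p)) (splitBias b s ∘ e'') N,
      ?_, fun y => ?_⟩
    · simp only [size, Function.comp]
      rw [ncard_layer_eq e e'' (splitWeight W s) (splitBias b s)]
      have := sum_nz_split_le W b s
      lia
    · rw [eval]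
      simp only [mulVec_reindex e e'' (splitWeight W s)]
      refine (hev fun q => max (∑ p, splitWeight W s q p * y p + splitBias b s q) 0).trans ?_
      congr 2
      funext k
      rw [hx, split_eval]

/-- A chain of sparse layers is realized by a ReLU network of comparable size. -/
theorem Chain.exists_net {ι κ : Type} [Fintype ι] {w L : ℕ} {f : (ι → ℝ) → (κ → ℝ)}
    (h : Chain w ι κ L f) {n m : ℕ} (e : Fin n ≃ ι) (e' : Fin m ≃ κ) :
    ∃ N : ReLUNet n m, N.size ≤ 2 * n + L * (4 * w) + 2 * m ∧
      ∀ x : ι → ℝ, N.eval (x ∘ e) = f x ∘ e' := by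
  classical
  let e'' := (Fintype.equivFin (ι ⊕ ι)).symm
  obtain ⟨N, hN, hev⟩ := h.exists_net_split e'' e'
  let W : ι ⊕ ι → ι → ℝ := Sum.elim (fun i => Pi.single i 1) (fun i => -Pi.single i 1)
  refine ⟨layer (Matrix.of fun q p => W (e'' q) (e p)) ((fun _ => 0) ∘ e'') N, ?_, fun x => ?_⟩
  · have hn : n = Fintype.card ι := by simpa using Fintype.card_congr e
    have hz : ∀ k, ∑ i, nz ((Pi.single k 1 : ι → ℝ) i) = 1 := fun k => by
      simp [Pi.single_apply, nz]
    simp only [size, Function.comp]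
    rw [ncard_layer_eq e e'' W fun _ => 0]
    simp only [W, Fintype.sum_sum_type, Sum.elim_inl, Sum.elim_inr, Pi.neg_apply, nz_neg, hz]
    simp
    lia
  · rw [eval]
    simp only [mulVec_reindex e e'' W]
    refine (hev fun q => max (∑ p, W q p * x p + 0) 0).trans ?_
    congr 2
    funext i
    simp [W, Pi.single_apply, max_zero_sub_max_neg_zero_eq_self]

theorem SparseAffine.isGate_relu {ι : Type} {n : ℕ} {φ : (ι → ℝ) → ℝ} (h : SparseAffine n φ) :
    IsGate n fun x => max (φ x) 0 := Or.inr ⟨φ, h, rfl⟩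

/-! ### Approximate multiplication of scalars -/

/-- Initial state for the multiplication of `x` and `y`: the positive and negative parts of
`(x + y) / (2R)` and of `(x - y) / (2R)`, and a zero accumulator. -/
noncomputable def mulInit (R : ℝ) (x : Bool × Unit × Unit → ℝ) : Fin 5 → ℝ :=
  ![max ((2 * R)⁻¹ * x (false, (), ()) + (2 * R)⁻¹ * x (true, (), ())) 0,
    max (-(2 * R)⁻¹ * x (false, (), ()) + -(2 * R)⁻¹ * x (true, (), ())) 0,
    max ((2 * R)⁻¹ * x (false, (), ()) + -(2 * R)⁻¹ * x (true, (), ())) 0,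
    max (-(2 * R)⁻¹ * x (false, (), ()) + (2 * R)⁻¹ * x (true, (), ())) 0,
    0]

/-- One refinement `t ↦ |2t - 1|` of both squares, based on `4t² = (4t - 1) + (2t - 1)²`. -/
noncomputable def mulStep (s : Fin 5 → ℝ) : Fin 5 → ℝ :=
  ![max (2 * s 0 + 2 * s 1 + -1) 0,
    max (-2 * s 0 + -2 * s 1 + 1) 0,
    max (2 * s 2 + 2 * s 3 + -1) 0,
    max (-2 * s 2 + -2 * s 3 + 1) 0,
    4 * s 4 + 4 * s 0 + 4 * s 1 + -4 * s 2 + -4 * s 3]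

theorem isLayer_mulInit (R : ℝ) : IsLayer 10 (mulInit R) := by
  have h : ∀ a b : ℝ, SparseAffine 2
      fun x : Bool × Unit × Unit → ℝ => a * x (false, (), ()) + b * x (true, (), ()) :=
    fun a b => (SparseAffine.term a _).add (SparseAffine.term b _)
  refine ⟨fun _ => 2, fun k => ?_, by simp⟩
  fin_cases k
  · exact (h _ _).isGate_relu
  · exact (h _ _).isGate_relu
  · exact (h _ _).isGate_relu
  · exact (h _ _).isGate_relu
  · exact Or.inl (SparseAffine.zero.mono (by simp))

theorem isLayer_mulStep : IsLayer 25 mulStep := by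
  have h : ∀ (a b c : ℝ) (i j : Fin 5), SparseAffine 5
      fun s : Fin 5 → ℝ => a * s i + b * s j + c := fun a b c i j =>
    (((SparseAffine.term a i).add (SparseAffine.term b j)).add
      (SparseAffine.const c)).mono (by simp)
  refine ⟨fun _ => 5, fun k => ?_, by simp⟩
  fin_cases k
  · exact (h _ _ _ _ _).isGate_relu
  · exact (h _ _ _ _ _).isGate_relu
  · exact (h _ _ _ _ _).isGate_relu
  · exact (h _ _ _ _ _).isGate_relu
  · exact Or.inl (((((SparseAffine.term _ _).add (SparseAffine.term _ _)).add
      (SparseAffine.term _ _)).add (SparseAffine.term _ _)).add (SparseAffine.term _ _))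

theorem max_add_max_neg (z : ℝ) : max z 0 + max (-z) 0 = |z| := by
  rcases le_total 0 z with h | h
  · rw [max_eq_left h, max_eq_right (by linarith), abs_of_nonneg h, add_zero]
  · rw [max_eq_right h, max_eq_left (by linarith), abs_of_nonpos h, zero_add]

theorem mulStep_iterate (s : Fin 5 → ℝ) (h1 : s 0 + s 1 ∈ Set.Icc (0 : ℝ) 1)
    (h2 : s 2 + s 3 ∈ Set.Icc (0 : ℝ) 1) (m : ℕ) :
    |mulStep^[m] s 4 - 4 ^ m * (s 4 + (s 0 + s 1) ^ 2 - (s 2 + s 3) ^ 2)| ≤ 1 := by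
  induction m generalizing s with
  | zero =>
    simp only [Function.iterate_zero, id, pow_zero, one_mul]
    have := h1.1; have := h1.2; have := h2.1; have := h2.2
    rw [abs_le]
    constructor <;> nlinarith
  | succ m ih =>
    rw [Function.iterate_succ_apply]
    have e1 : mulStep s 0 + mulStep s 1 = |2 * (s 0 + s 1) - 1| := by
      rw [← max_add_max_neg]
      simp only [mulStep, Matrix.cons_val]
      congr 2 <;> ring
    have e2 : mulStep s 2 + mulStep s 3 = |2 * (s 2 + s 3) - 1| := by
      rw [← max_add_max_neg]
      simp only [mulStep, Matrix.cons_val]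
      congr 2 <;> ring
    have e3 : mulStep s 4 = 4 * s 4 + 4 * s 0 + 4 * s 1 + -4 * s 2 + -4 * s 3 := by
      simp only [mulStep, Matrix.cons_val]
    have key : ∀ t ∈ Set.Icc (0 : ℝ) 1, |2 * t - 1| ∈ Set.Icc (0 : ℝ) 1 := fun t ht =>
      ⟨abs_nonneg _, abs_le.2 ⟨by linarith [ht.1], by linarith [ht.2]⟩⟩
    have := ih (mulStep s) (e1 ▸ key _ h1) (e2 ▸ key _ h2)
    rw [e1, e2, e3, sq_abs, sq_abs] at this
    convert this using 3
    ring

/-- Matrices indexed by `I` with entries bounded by `R` can be multiplied with entrywise error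
`τ` by a chain of `L` layers with `w` terms each. -/
def HasApproxMul (I : Type) [Fintype I] (L w : ℕ) (R τ : ℝ) : Prop :=
  ∃ P : (Bool × I × I → ℝ) → (I × I → ℝ), Chain w (Bool × I × I) (I × I) L P ∧
    ∀ x, (∀ z, |x z| ≤ R) → ∀ i j,
      |P x (i, j) - ∑ l, x (false, i, l) * x (true, l, j)| ≤ τ

theorem hasApproxMul_unit {R : ℝ} (hR : 0 < R) (m : ℕ) :
    HasApproxMul Unit (m + 2) 25 R (R ^ 2 / 4 ^ m) := by
  refine ⟨(fun s _ => R ^ 2 / 4 ^ m * s 4) ∘ mulStep^[m] ∘ mulInit R, ?_, ?_⟩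
  · have h0 := Chain.single (isLayer_mulInit R)
    have h1 := (Chain.single isLayer_mulStep).iterate m
    have h2 : Chain 25 (Fin 5) (Unit × Unit) 1 (fun s _ => R ^ 2 / 4 ^ m * s 4) :=
      Chain.single (IsLayer.of_affine 1 (fun _ => SparseAffine.term _ _) (by simp))
    have := ((h0.mono (by simp)).comp h1).comp h2
    rwa [show 1 + m * 1 + 1 = m + 2 by ring] at this
  · intro x hx i j
    set a := x (false, (), ()) with ha
    set b := x (true, (), ()) with hb
    have hab := hx (false, (), ())
    have hbb := hx (true, (), ())
    rw [← ha] at hab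
    rw [← hb] at hbb
    set s := mulInit R x with hs
    have e1 : s 0 + s 1 = |(2 * R)⁻¹ * a + (2 * R)⁻¹ * b| := by
      rw [← max_add_max_neg]
      simp only [hs, mulInit, Matrix.cons_val]
      congr 2
      ring
    have e2 : s 2 + s 3 = |(2 * R)⁻¹ * a + -(2 * R)⁻¹ * b| := by
      rw [← max_add_max_neg]
      simp only [hs, mulInit, Matrix.cons_val]
      congr 2
      ring
    have e3 : s 4 = 0 := by simp [hs, mulInit]
    have key : ∀ c, |c| ≤ R → |(2 * R)⁻¹ * a + (2 * R)⁻¹ * c| ∈ Set.Icc (0 : ℝ) 1 := by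
      intro c hc
      refine ⟨abs_nonneg _, ?_⟩
      rw [← mul_add, abs_mul, abs_of_pos (by positivity : 0 < (2 * R)⁻¹),
        inv_mul_le_iff₀ (by positivity)]
      linarith [abs_add_le a c]
    have h1 : s 0 + s 1 ∈ Set.Icc (0 : ℝ) 1 := e1 ▸ key b hbb
    have h2 : s 2 + s 3 ∈ Set.Icc (0 : ℝ) 1 := by
      have := key (-b) (by rwa [abs_neg])
      rw [e2]
      convert this using 2
      ring
    have h := mulStep_iterate s h1 h2 m
    rw [e1, e2, e3, sq_abs, sq_abs] at h
    have e4 : R ^ 2 / 4 ^ m * mulStep^[m] s 4 - a * b = R ^ 2 / 4 ^ m * (mulStep^[m] s 4 -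
        4 ^ m * (0 + ((2 * R)⁻¹ * a + (2 * R)⁻¹ * b) ^ 2
          - ((2 * R)⁻¹ * a + -(2 * R)⁻¹ * b) ^ 2)) := by
      field_simp
      ring
    simp only [Function.comp, Finset.univ_unique, Finset.sum_singleton]
    change |R ^ 2 / 4 ^ m * mulStep^[m] s 4 - a * b| ≤ _
    rw [e4, abs_mul, abs_of_pos (by positivity : 0 < R ^ 2 / 4 ^ m)]
    exact mul_le_of_le_one_right (by positivity) h

/-! ### Strassen's algorithm -/

/-- Coefficients of the linear forms of Strassen's algorithm in the left (`false`) and right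
(`true`) factor. -/
def strassenIn : Bool → Fin 7 → Matrix (Fin 2) (Fin 2) ℝ
  | false => ![!![1, 0; 0, 1], !![0, 0; 1, 1], !![1, 0; 0, 0], !![0, 0; 0, 1], !![1, 1; 0, 0],
      !![-1, 0; 1, 0], !![0, 1; 0, -1]]
  | true => ![!![1, 0; 0, 1], !![1, 0; 0, 0], !![0, 1; 0, -1], !![-1, 0; 1, 0], !![0, 0; 0, 1],
      !![1, 1; 0, 0], !![0, 0; 1, 1]]

/-- Coefficients recombining the seven products of Strassen's algorithm. -/
def strassenOut : Fin 7 → Matrix (Fin 2) (Fin 2) ℝ :=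
  ![!![1, 0; 0, 1], !![0, 0; 1, -1], !![0, 1; 0, 1], !![1, 0; 1, 0], !![-1, 1; 0, 0],
    !![0, 0; 0, 1], !![1, 0; 0, 0]]

theorem abs_strassenIn_le (s : Bool) (t : Fin 7) (a b : Fin 2) : |strassenIn s t a b| ≤ 1 := by
  cases s <;> fin_cases t <;> fin_cases a <;> fin_cases b <;> simp [strassenIn]

theorem abs_strassenOut_le (t : Fin 7) (a b : Fin 2) : |strassenOut t a b| ≤ 1 := by
  fin_cases t <;> fin_cases a <;> fin_cases b <;> simp [strassenOut]

theorem strassen_identity (X Y : Fin 2 → Fin 2 → ℝ) (a b : Fin 2) :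
    ∑ t, strassenOut t a b * ((∑ p : Fin 2 × Fin 2, strassenIn false t p.1 p.2 * X p.1 p.2) *
      ∑ p : Fin 2 × Fin 2, strassenIn true t p.1 p.2 * Y p.1 p.2) = ∑ c, X a c * Y c b := by
  simp only [Fintype.sum_prod_type]
  fin_cases a <;> fin_cases b <;>
    simp [Fin.sum_univ_succ, strassenIn, strassenOut] <;> ring

theorem HasApproxMul.double {I : Type} [Fintype I] {L w w' : ℕ} {R τ : ℝ}
    (h : HasApproxMul I L w (4 * R) τ) (hw : 7 * w ≤ w') (hI : 56 * Fintype.card I ^ 2 ≤ w') :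
    HasApproxMul (Fin 2 × I) (L + 2) w' R (7 * τ) := by
  obtain ⟨P, hP, herr⟩ := h
  let split : (Bool × (Fin 2 × I) × (Fin 2 × I) → ℝ) → (Fin 7 × Bool × I × I → ℝ) := fun x z =>
    ∑ p : Fin 2 × Fin 2, strassenIn z.2.1 z.1 p.1 p.2 * x (z.2.1, (p.1, z.2.2.1), (p.2, z.2.2.2))
  let merge : (Fin 7 × I × I → ℝ) → ((Fin 2 × I) × (Fin 2 × I) → ℝ) := fun y z =>
    ∑ t, strassenOut t z.1.1 z.2.1 * y (t, z.1.2, z.2.2)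
  have hsplit : IsLayer w' split := by
    refine IsLayer.of_affine 4 (fun z => ?_) (le_trans (le_of_eq ?_) hI)
    · simpa using SparseAffine.sum (n := 1) (Finset.univ : Finset (Fin 2 × Fin 2)) fun p =>
        SparseAffine.term (strassenIn z.2.1 z.1 p.1 p.2) (z.2.1, (p.1, z.2.2.1), (p.2, z.2.2.2))
    · simp
      ring
  have hmerge : IsLayer w' merge := by
    refine IsLayer.of_affine 7 (fun z => ?_) (le_trans ?_ hI)
    · simpa using SparseAffine.sum (n := 1) (Finset.univ : Finset (Fin 7)) fun t =>
        SparseAffine.term (strassenOut t z.1.1 z.2.1) (t, z.1.2, z.2.2)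
    · simp only [Fintype.card_prod, Fintype.card_fin]
      nlinarith [Nat.zero_le (Fintype.card I ^ 2)]
  have hpar : Chain w' _ _ L _ := (hP.parallel (Fin 7)).mono (by simpa using hw)
  refine ⟨merge ∘ (fun x p => P (fun i => x (p.1, i)) p.2) ∘ split, ?_, ?_⟩
  · have := ((Chain.single hsplit).comp hpar).comp (Chain.single hmerge)
    rwa [show 1 + L + 1 = L + 2 by ring] at this
  · rintro x hx ⟨a, i⟩ ⟨b, j⟩
    have hb : ∀ t z, |split x (t, z)| ≤ 4 * R := fun t z => by
      refine (Finset.abs_sum_le_sum_abs _ _).trans ?_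
      have : ∀ p ∈ (Finset.univ : Finset (Fin 2 × Fin 2)),
          |strassenIn z.1 t p.1 p.2 * x (z.1, (p.1, z.2.1), (p.2, z.2.2))| ≤ R := fun p _ => by
        rw [abs_mul]
        exact (mul_le_of_le_one_left (abs_nonneg _) (abs_strassenIn_le _ _ _ _)).trans (hx _)
      simpa using Finset.sum_le_card_nsmul _ _ _ this
    have hexact : ∑ l, x (false, (a, i), l) * x (true, l, (b, j)) =
        ∑ t, strassenOut t a b *
          ∑ l, split x (t, false, i, l) * split x (t, true, l, j) := by
      simp only [Finset.mul_sum]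
      rw [Fintype.sum_prod_type_right]
      exact (Finset.sum_congr rfl fun l _ =>
        (strassen_identity (fun p q => x (false, (p, i), (q, l)))
          (fun p q => x (true, (p, l), (q, j))) a b).symm).trans Finset.sum_comm
    rw [hexact]
    simp only [Function.comp, merge]
    rw [← Finset.sum_sub_distrib]
    refine (Finset.abs_sum_le_sum_abs _ _).trans ?_
    have : ∀ t ∈ (Finset.univ : Finset (Fin 7)),
        |strassenOut t a b * P (fun z => split x (t, z)) (i, j) - strassenOut t a b *
          ∑ l, split x (t, false, i, l) * split x (t, true, l, j)| ≤ τ := fun t _ => by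
      rw [← mul_sub, abs_mul]
      exact (mul_le_of_le_one_left (abs_nonneg _) (abs_strassenOut_le _ _ _)).trans
        (herr (fun z => split x (t, z)) (hb t) i j)
    simpa using Finset.sum_le_card_nsmul _ _ _ this

theorem exists_hasApproxMul_two_pow {R : ℝ} (hR : 0 < R) (m k : ℕ) :
    ∃ (I : Type) (_ : Fintype I), Fintype.card I = 2 ^ k ∧
      HasApproxMul I (m + 2 + 2 * k) (56 * 7 ^ k) R (7 ^ k * ((4 ^ k * R) ^ 2 / 4 ^ m)) := by
  induction k generalizing R with
  | zero =>
    obtain ⟨P, hP, h⟩ := hasApproxMul_unit hR m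
    exact ⟨Unit, inferInstance, by simp, P, hP.mono (by simp), by simpa using h⟩
  | succ k ih =>
    obtain ⟨I, _, hI, h⟩ := ih (R := 4 * R) (by positivity)
    refine ⟨Fin 2 × I, inferInstance, by simp [hI, pow_succ, mul_comm], ?_⟩
    have := h.double (w' := 56 * 7 ^ (k + 1)) (by rw [pow_succ]; lia) (by
      rw [hI, ← pow_mul, mul_comm k, pow_mul, pow_succ]
      have : (2 ^ 2) ^ k ≤ 7 ^ k := Nat.pow_le_pow_left (by simp) k
      lia)
    convert this using 1 <;> ring

theorem HasApproxMul.restrict {I J : Type} [Fintype I] [Fintype J] {L w : ℕ} {R τ : ℝ}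
    (h : HasApproxMul I L w R τ) (hR : 0 ≤ R) (e : J ↪ I) (hw : 2 * Fintype.card I ^ 2 ≤ w) :
    HasApproxMul J (L + 2) w R τ := by
  classical
  obtain ⟨P, hP, herr⟩ := h
  let inv : I → Option J := Function.partialInv e
  have hinv : ∀ j, inv (e j) = some j := Function.partialInv_left e.injective
  have hinv' : ∀ i j, inv i = some j → e j = i := fun i j h =>
    (e.injective.isPartialInv j i).1 h
  let pad : (Bool × J × J → ℝ) → (Bool × I × I → ℝ) := fun x z =>
    (inv z.2.1).elim 0 fun i => (inv z.2.2).elim 0 fun j => x (z.1, i, j)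
  let crop : (I × I → ℝ) → (J × J → ℝ) := fun y z => y (e z.1, e z.2)
  have hpad : IsLayer w pad := by
    refine IsLayer.of_affine 1 (fun z => ?_) (le_trans (le_of_eq ?_) hw)
    · simp only [pad]
      cases inv z.2.1 with
      | none => exact SparseAffine.const 0
      | some i =>
        cases inv z.2.2 with
        | none => exact SparseAffine.const 0
        | some j => exact SparseAffine.proj _
    · simp
      ring
  have hcrop : IsLayer w crop := by
    refine IsLayer.of_affine 1 (fun z => SparseAffine.proj _) (le_trans ?_ hw)
    have := Fintype.card_le_of_embedding e
    simp only [Fintype.card_prod]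
    nlinarith
  refine ⟨crop ∘ P ∘ pad, ?_, fun x hx i j => ?_⟩
  · have := ((Chain.single hpad).comp hP).comp (Chain.single hcrop)
    rwa [show 1 + L + 1 = L + 2 by ring] at this
  · have hb : ∀ z, |pad x z| ≤ R := fun z => by
      simp only [pad]
      cases inv z.2.1 with
      | none => simpa using hR
      | some i =>
        cases inv z.2.2 with
        | none => simpa using hR
        | some j => exact hx _
    have hsum : ∑ l, x (false, i, l) * x (true, l, j) =
        ∑ l, pad x (false, e i, l) * pad x (true, l, e j) := by
      refine Finset.sum_of_injOn e e.injective.injOn (by simp) (fun l _ hl => ?_) fun l _ => ?_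
      · have : inv l = none := by
          cases h : inv l with
          | none => rfl
          | some j => exact absurd ⟨j, by simp, hinv' _ _ h⟩ hl
        simp [pad, this]
      · simp [pad, hinv]
    rw [hsum]
    exact herr _ hb _ _

/-! ### Spectral norm -/

open scoped Matrix.Norms.L2Operator in
theorem specNorm_eq_norm {d : ℕ} (A : Matrix (Fin d) (Fin d) ℝ) : specNorm A = ‖A‖ := rfl

theorem abs_entry_le_specNorm {d : ℕ} (A : Matrix (Fin d) (Fin d) ℝ) (i j : Fin d) :
    |A i j| ≤ specNorm A := by
  have h := (LinearMap.toContinuousLinearMap (Matrix.toEuclideanLin A)).le_opNorm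
    (EuclideanSpace.single j 1)
  have h' := (PiLp.norm_apply_le ((LinearMap.toContinuousLinearMap (Matrix.toEuclideanLin A))
    (EuclideanSpace.single j 1)) i).trans h
  simpa [specNorm, Matrix.toLpLin_apply] using h'

theorem specNorm_le_of_entry_le {d : ℕ} {A : Matrix (Fin d) (Fin d) ℝ} {η : ℝ} (hη : 0 ≤ η)
    (h : ∀ i j, |A i j| ≤ η) : specNorm A ≤ d * η := by
  refine ContinuousLinearMap.opNorm_le_bound _ (by positivity) fun x => ?_
  refine (sq_le_sq₀ (norm_nonneg _) (by positivity)).1 ?_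
  rw [EuclideanSpace.norm_sq_eq]
  have hrow : ∀ i, ‖(LinearMap.toContinuousLinearMap (Matrix.toEuclideanLin A)) x i‖ ^ 2
      ≤ η ^ 2 * (d * ‖x‖ ^ 2) := fun i => by
    have e : (LinearMap.toContinuousLinearMap (Matrix.toEuclideanLin A)) x i
        = ∑ j, A i j * x j := by
      simp [Matrix.toLpLin_apply, Matrix.mulVec, dotProduct]
    rw [e, Real.norm_eq_abs, sq_abs]
    refine (Finset.sum_mul_sq_le_sq_mul_sq _ _ _).trans ?_
    have h1 : ∑ j, A i j ^ 2 ≤ d * η ^ 2 := by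
      have := Finset.sum_le_card_nsmul Finset.univ (fun j => A i j ^ 2) (η ^ 2)
        fun j _ => sq_le_sq' (by linarith [neg_le_of_abs_le (h i j)]) (le_of_abs_le (h i j))
      simpa using this
    have h2 : ∑ j, x j ^ 2 = ‖x‖ ^ 2 := by simp [EuclideanSpace.norm_sq_eq]
    rw [h2]
    nlinarith [sq_nonneg ‖x‖]
  have := Finset.sum_le_card_nsmul Finset.univ _ _ fun i _ => hrow i
  refine this.trans (le_of_eq ?_)
  simp
  ring

/-! ### Neumann series -/

/-- One step `S ↦ 1 + A S` of Horner's scheme for the Neumann series, on the state `(A, S)`. -/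
def hornerStep {J : Type} [DecidableEq J] (P : (Bool × J × J → ℝ) → (J × J → ℝ))
    (z : Bool × J × J → ℝ) (q : Bool × J × J) : ℝ :=
  if q.1 then P z q.2 + (1 : Matrix J J ℝ) q.2.1 q.2.2 else z (false, q.2)

theorem chain_hornerStep {J : Type} [Fintype J] [DecidableEq J] {L w w' : ℕ}
    {P : (Bool × J × J → ℝ) → (J × J → ℝ)} (hP : Chain w (Bool × J × J) (J × J) L P)
    (hw : w + 4 * Fintype.card J ^ 2 ≤ w') :
    Chain w' (Bool × J × J) (Bool × J × J) (L + 2) (hornerStep P) := by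
  let copy : (Bool × J × J → ℝ) → ((Bool × J × J) ⊕ (J × J) → ℝ) := fun x =>
    Sum.elim x fun p => x (false, p)
  let merge : ((J × J) ⊕ (J × J) → ℝ) → (Bool × J × J → ℝ) := fun y q =>
    if q.1 then y (Sum.inl q.2) + (1 : Matrix J J ℝ) q.2.1 q.2.2 else y (Sum.inr q.2)
  have hcopy : IsLayer w' copy := by
    refine IsLayer.of_affine 1 ?_ (le_trans ?_ hw)
    · rintro (z | z) <;> exact SparseAffine.proj _
    · simp only [Fintype.card_sum, Fintype.card_prod, Fintype.card_bool]
      nlinarith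
  have hmerge : IsLayer w' merge := by
    refine IsLayer.of_affine 2 ?_ (le_trans ?_ hw)
    · rintro ⟨_ | _, p⟩
      · exact (SparseAffine.proj (Sum.inr p)).mono (by simp)
      · exact (SparseAffine.proj (Sum.inl p)).add (SparseAffine.const _)
    · simp only [Fintype.card_prod, Fintype.card_bool]
      nlinarith
  have hmid : Chain w' _ _ L _ := (hP.carry (J × J)).mono (w' := w') (by
    refine le_trans ?_ hw
    simp only [Fintype.card_prod]
    nlinarith)
  have := ((Chain.single hcopy).comp hmid).comp (Chain.single hmerge)
  rwa [show 1 + L + 1 = L + 2 by ring] at this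

/-- The state `(1 - B, 0)` at which Horner's scheme starts. -/
def hornerInit {J : Type} [DecidableEq J] (x : J × J → ℝ) (q : Bool × J × J) : ℝ :=
  if q.1 then 0 else -1 * x q.2 + (1 : Matrix J J ℝ) q.2.1 q.2.2

theorem isLayer_hornerInit {J : Type} [Fintype J] [DecidableEq J] :
    IsLayer (4 * Fintype.card J ^ 2) (hornerInit (J := J)) := by
  refine IsLayer.of_affine 2 ?_ (le_of_eq ?_)
  · rintro ⟨_ | _, p⟩
    · exact (SparseAffine.term (-1) p).add (SparseAffine.const _)
    · exact SparseAffine.zero.mono (by simp)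
  · simp
    ring

open scoped Matrix.Norms.L2Operator in
theorem specNorm_horner_sub_le {d : ℕ} {δ η R : ℝ} (hδ : 0 < δ) (hδ1 : δ < 1) (hη : 0 ≤ η)
    (hR : 2 / δ + η / δ ≤ R) {P : (Bool × Fin d × Fin d → ℝ) → (Fin d × Fin d → ℝ)}
    (hP : ∀ x, (∀ z, |x z| ≤ R) → ∀ i j,
      |P x (i, j) - ∑ l, x (false, i, l) * x (true, l, j)| ≤ η / d)
    {B : Matrix (Fin d) (Fin d) ℝ} (hB : specNorm (1 - B) ≤ 1 - δ) (k : ℕ) :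
    IsUnit B ∧ specNorm (Matrix.of (fun i j => (hornerStep P)^[k]
      (hornerInit fun p => B p.1 p.2) (true, i, j)) - B⁻¹) ≤ (1 - δ) ^ k / δ + η / δ := by
  have hU : IsUnit B := by
    have : ‖1 - B‖ < 1 := by
      rw [← specNorm_eq_norm]
      linarith
    simpa using isUnit_one_sub_of_norm_lt_one this
  refine ⟨hU, ?_⟩
  set z : ℕ → Bool × Fin d × Fin d → ℝ :=
    fun k => (hornerStep P)^[k] (hornerInit fun p => B p.1 p.2) with hz
  have hzs : ∀ k, z (k + 1) = hornerStep P (z k) := fun k =>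
    Function.iterate_succ_apply' _ _ _
  have hA : ∀ k i j, z k (false, i, j) = (1 - B) i j := by
    intro k i j
    induction k with
    | zero => simp [hz, hornerInit, Matrix.sub_apply]; ring
    | succ k ih => rw [hzs]; simpa [hornerStep] using ih
  have hinv : B * B⁻¹ = 1 := Matrix.mul_nonsing_inv _ ((Matrix.isUnit_iff_isUnit_det _).1 hU)
  have hfix : B⁻¹ = 1 + (1 - B) * B⁻¹ := by
    rw [sub_mul, hinv, one_mul]
    abel
  have hone : ‖(1 : Matrix (Fin d) (Fin d) ℝ)‖ ≤ 1 := by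
    rw [← Matrix.diagonal_one, Matrix.l2_opNorm_diagonal]
    exact (pi_norm_le_iff_of_nonneg zero_le_one).2 fun i => by simp
  have hBn : ‖1 - B‖ ≤ 1 - δ := hB
  have hinvn : ‖B⁻¹‖ ≤ 1 / δ := by
    have h1 : ‖B⁻¹‖ ≤ 1 + (1 - δ) * ‖B⁻¹‖ := by
      nth_rewrite 1 [hfix]
      refine (norm_add_le _ _).trans (add_le_add hone ((norm_mul_le _ _).trans ?_))
      gcongr
    rw [le_div_iff₀ hδ]
    linarith
  change specNorm (Matrix.of (fun i j => z k (true, i, j)) - B⁻¹) ≤ _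
  rw [specNorm_eq_norm]
  induction k with
  | zero =>
    have : Matrix.of (fun i j => z 0 (true, i, j)) = 0 := by
      ext i j
      simp [hz, hornerInit]
    rw [this, zero_sub, norm_neg, pow_zero]
    have : 0 ≤ η / δ := by positivity
    linarith
  | succ k ih =>
    set S : Matrix (Fin d) (Fin d) ℝ := Matrix.of fun i j => z k (true, i, j) with hS
    have hpow : (1 - δ) ^ k ≤ 1 := pow_le_one₀ (by linarith) (by linarith)
    have hSn : ‖S‖ ≤ R := by
      have h1 : ‖S‖ ≤ ‖S - B⁻¹‖ + ‖B⁻¹‖ := by simpa using norm_add_le (S - B⁻¹) B⁻¹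
      have h2 : (1 - δ) ^ k / δ ≤ 1 / δ := by gcongr
      have h3 : 2 / δ = 1 / δ + 1 / δ := by ring
      linarith
    have hbound : ∀ q, |z k q| ≤ R := by
      rintro ⟨_ | _, i, j⟩
      · rw [hA]
        refine (abs_entry_le_specNorm _ i j).trans (hB.trans ?_)
        have h1 : 1 ≤ 2 / δ := by rw [le_div_iff₀ hδ]; linarith
        have : 0 ≤ η / δ := by positivity
        linarith
      · exact (abs_entry_le_specNorm S i j).trans hSn
    set S' : Matrix (Fin d) (Fin d) ℝ := Matrix.of fun i j => z (k + 1) (true, i, j) with hS'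
    have hE : ‖S' - (1 + (1 - B) * S)‖ ≤ η := by
      rw [← specNorm_eq_norm]
      have hentry : ∀ i j, |(S' - (1 + (1 - B) * S)) i j| ≤ η / d := fun i j => by
        have := hP (z k) hbound i j
        simp only [hA] at this
        convert this using 2
        simp only [hS', hS, Matrix.sub_apply, Matrix.add_apply, Matrix.of_apply, hzs,
          Matrix.mul_apply, hornerStep, if_true]
        ring
      refine (specNorm_le_of_entry_le (by positivity) hentry).trans ?_
      rcases eq_or_ne (d : ℝ) 0 with h0 | h0
      · simpa [h0] using hη
      · rw [mul_div_cancel₀ _ h0]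
    have hsplit : S' - B⁻¹ = (S' - (1 + (1 - B) * S)) + (1 - B) * (S - B⁻¹) := by
      nth_rewrite 1 [hfix]
      noncomm_ring
    rw [hsplit]
    calc ‖(S' - (1 + (1 - B) * S)) + (1 - B) * (S - B⁻¹)‖
        ≤ η + (1 - δ) * ((1 - δ) ^ k / δ + η / δ) := by
          refine (norm_add_le _ _).trans (add_le_add hE ((norm_mul_le _ _).trans ?_))
          have : 0 ≤ 1 - δ := by linarith
          gcongr
      _ = (1 - δ) ^ (k + 1) / δ + η / δ := by
          field_simp
          ring

/-- An approximate multiplication yields an approximate inversion by Horner's scheme. -/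
theorem HasApproxMul.exists_inverse_net {d L w : ℕ} {δ η R : ℝ} (hδ : 0 < δ) (hδ1 : δ < 1)
    (hη : 0 ≤ η) (hR : 2 / δ + η / δ ≤ R) (h : HasApproxMul (Fin d) L w R (η / d)) (k : ℕ) :
    ∃ Φ : ReLUNet (d * d) (d * d),
      Φ.size ≤ 4 * d ^ 2 + (k * (L + 2) + 2) * (4 * (w + 4 * d ^ 2)) ∧
      ∀ B : Matrix (Fin d) (Fin d) ℝ, specNorm (1 - B) ≤ 1 - δ →
        IsUnit B ∧ specNorm (vecToMat (Φ.eval (matToVec B)) - B⁻¹)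
          ≤ (1 - δ) ^ k / δ + η / δ := by
  obtain ⟨P, hP, herr⟩ := h
  have h1 : Chain (w + 4 * d ^ 2) _ _ 1 (hornerInit (J := Fin d)) :=
    (Chain.single isLayer_hornerInit).mono (by simp)
  have h2 := (chain_hornerStep hP (w' := w + 4 * d ^ 2) (by simp)).iterate k
  have h3 : Chain (w + 4 * d ^ 2) (Bool × Fin d × Fin d) (Fin d × Fin d) 1
      (fun y p => y (true, p)) :=
    Chain.single (IsLayer.of_affine 1 (fun p => SparseAffine.proj _) (by simp; nlinarith))
  obtain ⟨N, hN, hev⟩ := ((h1.comp h2).comp h3).exists_net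
    finProdFinEquiv.symm finProdFinEquiv.symm
  refine ⟨N, hN.trans (le_of_eq (by ring)), fun B hB => ?_⟩
  have := specNorm_horner_sub_le hδ hδ1 hη hR herr hB k
  convert this using 4
  have e : matToVec B = (fun p : Fin d × Fin d => B p.1 p.2) ∘ finProdFinEquiv.symm := rfl
  ext i j
  rw [e, hev]
  simp [vecToMat]

theorem succ_mul_seven_pow_le (k : ℕ) : (k + 1) * 7 ^ k ≤ 7 * 8 ^ k := by
  have h : k + 7 ≤ 7 * (8 / 7 : ℚ) ^ k := by
    have := one_add_mul_le_pow (a := (1 / 7 : ℚ)) (by norm_num) k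
    norm_num at this
    linarith
  have h' : ((k + 1) * 7 ^ k : ℚ) ≤ 7 * 8 ^ k := by
    have : ((k : ℚ) + 1) * 7 ^ k ≤ (7 * (8 / 7 : ℚ) ^ k) * 7 ^ k := by
      gcongr
      linarith
    rwa [mul_assoc, ← mul_pow, div_mul_cancel₀ _ (by norm_num)] at this
  exact_mod_cast h'

theorem exists_two_pow_between {d : ℕ} (hd : 0 < d) : ∃ k, d ≤ 2 ^ k ∧ 2 ^ k ≤ 2 * d := by
  refine ⟨Nat.log 2 d + 1, (Nat.lt_pow_succ_log_self (by simp) d).le, ?_⟩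
  rw [pow_succ, mul_comm]
  exact Nat.mul_le_mul_left 2 (Nat.pow_log_le_self 2 hd.ne')

theorem strassen_error_le {d k c n : ℕ} {δ ε R : ℝ} (hd : 0 < d) (hk : d ≤ 2 ^ k)
    (hδ : 0 < δ) (hc : 2 * R ^ 2 ≤ δ * 4 ^ c) (hn : 1 ≤ ε * 4 ^ n) :
    7 ^ k * ((4 ^ k * R) ^ 2 / 4 ^ (4 * k + c + n)) ≤ ε * δ / 2 / d := by
  have hd' : (0 : ℝ) < d := by exact_mod_cast hd
  have hk' : (d : ℝ) ≤ 2 ^ k := by exact_mod_cast hk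
  rw [le_div_iff₀ hd', mul_div_assoc', div_mul_eq_mul_div, div_le_iff₀ (by positivity)]
  calc 7 ^ k * (4 ^ k * R) ^ 2 * (d : ℝ)
      ≤ 7 ^ k * (4 ^ k * R) ^ 2 * 2 ^ k := by gcongr
    _ = 224 ^ k * R ^ 2 := by
        rw [mul_pow, ← pow_mul, mul_comm k, pow_mul, show (224 : ℝ) = 7 * 4 ^ 2 * 2 by norm_num,
          mul_pow, mul_pow]
        ring
    _ ≤ 256 ^ k * (δ * 4 ^ c / 2) := by
        gcongr
        · norm_num
        · linarith
    _ ≤ 256 ^ k * (δ * 4 ^ c / 2) * (ε * 4 ^ n) := le_mul_of_one_le_right (by positivity) hn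
    _ = ε * δ / 2 * 4 ^ (4 * k + c + n) := by
        rw [pow_add, pow_add, pow_mul, show (4 : ℝ) ^ 4 = 256 by norm_num]
        ring

theorem inverse_net_size_le {d k c n r : ℕ} (hn : 1 ≤ n) (hk : d ≤ 2 ^ k) (hk' : 2 ^ k ≤ 2 * d) :
    4 * d ^ 2 + (r * n * (4 * k + c + n + 2 + 2 * k + 2 + 2) + 2) * (4 * (56 * 7 ^ k + 4 * d ^ 2))
      ≤ 13440 * (r * (c + 13) + 3) * d ^ 3 * n ^ 2 := by
  have hd : d ^ 2 ≤ 7 ^ k := calc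
    d ^ 2 ≤ (2 ^ k) ^ 2 := Nat.pow_le_pow_left hk 2
    _ = (2 ^ 2) ^ k := by rw [← pow_mul, mul_comm, pow_mul]
    _ ≤ 7 ^ k := Nat.pow_le_pow_left (by simp) k
  have h8 : 8 ^ k ≤ 8 * d ^ 3 := calc
    8 ^ k = (2 ^ k) ^ 3 := by rw [← pow_mul, mul_comm, pow_mul]; rfl
    _ ≤ (2 * d) ^ 3 := Nat.pow_le_pow_left hk' 3
    _ = 8 * d ^ 3 := by ring
  have h7 := succ_mul_seven_pow_le k
  obtain ⟨n, rfl⟩ := Nat.exists_eq_add_of_le' hn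
  have hL : 4 * k + c + (n + 1) + 2 + 2 * k + 2 + 2 ≤ (c + 13) * (n + 1) * (k + 1) := by
    nlinarith [Nat.zero_le (n * k), Nat.zero_le (c * n), Nat.zero_le (c * k),
      Nat.zero_le (c * n * k)]
  have hone : 1 ≤ (n + 1) ^ 2 * (k + 1) := Nat.one_le_iff_ne_zero.2 (by positivity)
  calc _ ≤ 4 * 7 ^ k + (r * (n + 1) * ((c + 13) * (n + 1) * (k + 1)) + 2)
          * (4 * (56 * 7 ^ k + 4 * 7 ^ k)) := by gcongr
    _ ≤ 240 * 7 ^ k * (r * (n + 1) * ((c + 13) * (n + 1) * (k + 1)) + 3 * 1) := by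
        nlinarith [Nat.zero_le (7 ^ k)]
    _ ≤ 240 * 7 ^ k * (r * (n + 1) * ((c + 13) * (n + 1) * (k + 1))
          + 3 * ((n + 1) ^ 2 * (k + 1))) := by gcongr
    _ = 240 * (r * (c + 13) + 3) * (n + 1) ^ 2 * ((k + 1) * 7 ^ k) := by ring
    _ ≤ 240 * (r * (c + 13) + 3) * (n + 1) ^ 2 * (7 * (8 * d ^ 3)) := by
        exact Nat.mul_le_mul_left _ (h7.trans (Nat.mul_le_mul_left 7 h8))
    _ = _ := by ring

theorem pow_div_le_half {δ ε : ℝ} {r n : ℕ} (hδ : 0 < δ) (hδ1 : δ < 1) (hr : (1 - δ) ^ r ≤ δ / 4)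
    (hn : 1 ≤ n) (hε : 1 ≤ ε * 2 ^ n) : (1 - δ) ^ (r * n) / δ ≤ ε / 2 := by
  rw [div_le_iff₀ hδ, pow_mul]
  have hδn : δ ^ n ≤ δ := pow_le_of_le_one hδ.le hδ1.le (by lia)
  have h2n : (2 : ℝ) ≤ 2 ^ n := le_self_pow₀ (by norm_num) (by lia)
  have h1 : 0 ≤ 1 - δ := by linarith
  calc ((1 - δ) ^ r) ^ n ≤ (δ / 4) ^ n := by gcongr
    _ = δ ^ n / (2 ^ n * 2 ^ n) := by rw [div_pow, ← mul_pow]; norm_num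
    _ ≤ δ / (2 ^ n * 2) := by gcongr
    _ ≤ ε / 2 * δ := by
        rw [div_le_iff₀ (by positivity)]
        nlinarith

end ReLUNet

/-- **Approximate matrix inversion by ReLU networks.** There is `q > 0` such that for
every `δ ∈ (0,1)` there is `C(δ) > 0` with: for all `d ∈ ℕ` and `ε ∈ (0,1/2)` there is
a ReLU network `Φ : ℝ^{d×d} → ℝ^{d×d}` of size at most `C(δ) · d³ · log₂^q(1/ε)` such
that every `B` with `‖Id - B‖₂ ≤ 1 - δ` is invertible and `‖Φ(B) - B⁻¹‖₂ ≤ ε`. -/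
theorem relu_matrix_inversion_approx :
    ∃ q : ℝ, 0 < q ∧
      ∀ δ : ℝ, δ ∈ Set.Ioo (0 : ℝ) 1 →
        ∃ C : ℝ, 0 < C ∧
          ∀ d : ℕ, ∀ ε : ℝ, ε ∈ Set.Ioo (0 : ℝ) (1 / 2) →
            ∃ Φ : ReLUNet (d * d) (d * d),
              (Φ.size : ℝ) ≤ C * (d : ℝ) ^ 3 * Real.logb 2 (1 / ε) ^ q ∧
              ∀ B : Matrix (Fin d) (Fin d) ℝ, specNorm (1 - B) ≤ 1 - δ →
                IsUnit B ∧ specNorm (vecToMat (Φ.eval (matToVec B)) - B⁻¹) ≤ ε := by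
  refine ⟨2, by norm_num, fun δ ⟨hδ, hδ1⟩ => ?_⟩
  obtain ⟨c, hc⟩ := pow_unbounded_of_one_lt (2 * (3 / δ) ^ 2 / δ) (show (1 : ℝ) < 4 by norm_num)
  obtain ⟨r, hr⟩ := exists_pow_lt_of_lt_one (show 0 < δ / 4 by positivity)
    (show 1 - δ < 1 by linarith)
  refine ⟨53760 * (r * (c + 13) + 3), by positivity, fun d ε ⟨hε, hε1⟩ => ?_⟩
  rcases Nat.eq_zero_or_pos d with rfl | hd
  · exact ⟨ReLUNet.last 0 0, by simp [ReLUNet.size], fun B _ =>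
      ⟨by rw [Subsingleton.elim B 1]; exact isUnit_one, by
        rw [Subsingleton.elim (vecToMat _ - B⁻¹) 0]; simpa [specNorm] using hε.le⟩⟩
  set ℓ := Real.logb 2 (1 / ε) with hℓ
  have hℓ1 : 1 ≤ ℓ := by
    rw [hℓ, Real.le_logb_iff_rpow_le (by norm_num) (by positivity), Real.rpow_one,
      le_div_iff₀ hε]
    linarith
  set n := ⌈ℓ⌉₊ with hn_def
  have hℓn : ℓ ≤ n := Nat.le_ceil ℓ
  have hnℓ : (n : ℝ) ≤ 2 * ℓ := by linarith [Nat.ceil_lt_add_one (show 0 ≤ ℓ by linarith)]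
  have hn : 1 ≤ n := by exact_mod_cast hℓ1.trans hℓn
  have hεn : 1 ≤ ε * 2 ^ n := by
    have h : 1 / ε ≤ (2 : ℝ) ^ (n : ℝ) :=
      (Real.logb_le_iff_le_rpow (by norm_num) (by positivity)).1 hℓn
    rwa [Real.rpow_natCast, div_le_iff₀' hε] at h
  have hεn4 : 1 ≤ ε * 4 ^ n := hεn.trans (by gcongr; norm_num)
  obtain ⟨k, hk, hk'⟩ := ReLUNet.exists_two_pow_between hd
  obtain ⟨I, _, hI, hmul⟩ :=
    ReLUNet.exists_hasApproxMul_two_pow (show 0 < 3 / δ by positivity) (4 * k + c + n) k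
  obtain ⟨e⟩ := Function.Embedding.nonempty_of_card_le (α := Fin d) (β := I) (by simpa [hI])
  have hmul' := hmul.restrict (by positivity) e (by
    rw [hI, ← pow_mul, mul_comm k, pow_mul]
    have : (2 ^ 2) ^ k ≤ 7 ^ k := Nat.pow_le_pow_left (by simp) k
    lia)
  have hτ := ReLUNet.strassen_error_le (R := 3 / δ) hd hk hδ
    (by rw [div_lt_iff₀' hδ] at hc; exact hc.le) hεn4
  obtain ⟨P, hP, herr⟩ := hmul'
  obtain ⟨Φ, hsize, hΦ⟩ := ReLUNet.HasApproxMul.exists_inverse_net (η := ε * δ / 2) hδ hδ1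
    (by positivity) (R := 3 / δ) (by rw [← add_div]; gcongr; nlinarith)
    ⟨P, hP, fun x hx i j => (herr x hx i j).trans hτ⟩ (r * n)
  refine ⟨Φ, ?_, fun B hB => ⟨(hΦ B hB).1, (hΦ B hB).2.trans ?_⟩⟩
  · have h : (Φ.size : ℝ) ≤ 13440 * (r * (c + 13) + 3) * d ^ 3 * n ^ 2 := by
      exact_mod_cast hsize.trans (ReLUNet.inverse_net_size_le hn hk hk')
    refine h.trans ?_
    rw [Real.rpow_two]
    calc (13440 * (r * (c + 13) + 3) * d ^ 3 * n ^ 2 : ℝ)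
        ≤ 13440 * (r * (c + 13) + 3) * d ^ 3 * (2 * ℓ) ^ 2 := by gcongr
      _ = 53760 * (r * (c + 13) + 3) * d ^ 3 * ℓ ^ 2 := by ring
  · have h1 := ReLUNet.pow_div_le_half hδ hδ1 hr.le hn hεn
    have h2 : ε * δ / 2 / δ = ε / 2 := by field_simp
    linarith
end
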